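/- arXiv:2412.15470 — 2 statements merged into one kernel-verified Lean document; each statement's English description precedes it below -/
import Mathlib

section
/- For every real number T with T + 1 > 30610046000, one has N(T+1) − N(T) ≤ (1/(2π) + 0.20152)·log T + min{0.4892·log log T + 14.2040, 3.3769·log log T + 2.8062} + 1/(25T). -/
open Real

/-- `N(T)`: the number of zeros `ρ = β + iγ` of the Riemann zeta function with
`0 < β < 1` and `0 < γ ≤ T`. -/
noncomputable def zetaZeroCount (T : ℝ) : ℕ :=
  {ρ : ℂ | riemannZeta ρ = 0 ∧ 0 < ρ.re ∧ ρ.re < 1 ∧ 0 < ρ.im ∧ ρ.im ≤ T}.ncard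

/-- Exponential growth in the imaginary direction inside a vertical strip. -/
def ExpGrowthInStrip (a b : ℝ) (f : ℂ → ℂ) : Prop :=
  ∃ K C : ℝ, ∀ z : ℂ, a ≤ z.re → z.re ≤ b → K ≤ |z.im| → ‖f z‖ ≤ C * Real.exp (K * |z.im|)

lemma re_cos (z : ℂ) : (Complex.cos z).re = Real.cos z.re * Real.cosh z.im := by
  conv_lhs => rw [← Complex.re_add_im z]
  rw [Complex.cos_add, Complex.cos_mul_I, Complex.sin_mul_I]
  simp [← Complex.ofReal_cosh, ← Complex.ofReal_cos, ← Complex.ofReal_sinh, ← Complex.ofReal_sin]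

lemma closure_re_preimage_Ioo_subset (a b : ℝ) :
    closure (Complex.re ⁻¹' Set.Ioo a b) ⊆ Complex.re ⁻¹' Set.Icc a b :=
  closure_minimal (Set.preimage_mono Set.Ioo_subset_Icc_self)
    (isClosed_Icc.preimage Complex.continuous_re)

/-- A quantitative three lines theorem with boundary bounds of size `exp (E cosh (t - t₀))`. -/
lemma norm_le_of_strip_boundary {a b a' b' E L t₀ : ℝ} (hab : a < b) (hpi : b - a < π)
    (ha : a' < a) (hb : b < b') (hE : 0 ≤ E) {f : ℂ → ℂ}
    (hf : DifferentiableOn ℂ f (Complex.re ⁻¹' Set.Ioo a' b'))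
    (hg : ExpGrowthInStrip a b f)
    (hfa : ∀ z : ℂ, z.re = a →
      ‖f z‖ ≤ Real.exp (E * (Real.cos ((b - a) / 2) * Real.cosh (z.im - t₀)) + L))
    (hfb : ∀ z : ℂ, z.re = b →
      ‖f z‖ ≤ Real.exp (E * (Real.cos ((b - a) / 2) * Real.cosh (z.im - t₀))))
    {z : ℂ} (hza : a ≤ z.re) (hzb : z.re ≤ b) :
    ‖f z‖ ≤ Real.exp (E * Real.cosh (z.im - t₀) + L * ((b - z.re) / (b - a))) := by
  have hba : 0 < b - a := sub_pos.2 hab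
  set c : ℂ := ((a + b) / 2 : ℝ) + (t₀ : ℝ) * Complex.I with hc
  set h : ℂ → ℂ := fun w ↦ E * Complex.cos (w - c) + L * ((b - w) / (b - a : ℝ)) with hh
  have hre (w : ℂ) : (h w).re = E * (Real.cos (w.re - (a + b) / 2) * Real.cosh (w.im - t₀))
      + L * ((b - w.re) / (b - a)) := by
    have h1 : ((b - w) / ((b - a : ℝ) : ℂ)).re = (b - w.re) / (b - a) := by
      rw [Complex.div_ofReal_re]; simp
    simp only [hh, Complex.add_re, Complex.re_ofReal_mul, re_cos, h1]
    simp [hc]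
  have hg' : ∀ w : ℂ, ‖f w * Complex.exp (-h w)‖ = ‖f w‖ * Real.exp (-(h w).re) := by
    intro w; rw [norm_mul, Complex.norm_exp, Complex.neg_re]
  have key : ‖f z * Complex.exp (-h z)‖ ≤ 1 := by
    refine PhragmenLindelof.vertical_strip (a := a) (b := b)
      (f := fun w ↦ f w * Complex.exp (-h w)) ?_ ?_ ?_ ?_ hza hzb
    · refine DifferentiableOn.diffContOnCl (DifferentiableOn.mono ?_
        ((closure_re_preimage_Ioo_subset a b).trans
          (Set.preimage_mono (Set.Icc_subset_Ioo ha hb))))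
      refine hf.mul (Differentiable.differentiableOn ?_)
      simp only [hh]
      fun_prop
    · obtain ⟨K, C, hKC⟩ := hg
      refine ⟨1, by rw [lt_div_iff₀ hba]; simpa using hpi, |K|, ?_⟩
      refine Asymptotics.IsBigO.of_bound (|C| * Real.exp |L|) ?_
      rw [Filter.eventually_inf_principal]
      filter_upwards [(Filter.eventually_ge_atTop K).comap (_root_.abs ∘ Complex.im)] with w hw hs
      rw [hg', Real.norm_eq_abs, Real.abs_exp]
      have h1 : Real.exp (-(h w).re) ≤ Real.exp |L| := by
        rw [Real.exp_le_exp, hre]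
        have h2 : 0 ≤ Real.cos (w.re - (a + b) / 2) := by
          apply Real.cos_nonneg_of_mem_Icc
          constructor <;> linarith [hs.1, hs.2]
        have h3 : 0 ≤ (b - w.re) / (b - a) := div_nonneg (by linarith [hs.2]) hba.le
        have h4 : (b - w.re) / (b - a) ≤ 1 := (div_le_one hba).2 (by linarith [hs.1])
        have h5 : 0 ≤ E * (Real.cos (w.re - (a + b) / 2) * Real.cosh (w.im - t₀)) := by positivity
        have h6 : -L * ((b - w.re) / (b - a)) ≤ |L| * 1 :=
          mul_le_mul (neg_le_abs L) h4 h3 (abs_nonneg L)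
        linarith
      have h7 : ‖f w‖ ≤ |C| * Real.exp (|K| * Real.exp (1 * |w.im|)) := by
        refine (hKC w hs.1.le hs.2.le hw).trans ?_
        refine mul_le_mul (le_abs_self C) ?_ (Real.exp_pos _).le (abs_nonneg C)
        rw [Real.exp_le_exp]
        refine mul_le_mul (le_abs_self K) ?_ (abs_nonneg _) (abs_nonneg K)
        rw [one_mul]
        linarith [Real.add_one_le_exp |w.im|]
      calc _ ≤ (|C| * Real.exp (|K| * Real.exp (1 * |w.im|))) * Real.exp |L| := by gcongr
        _ = _ := by ring
    · intro w hw
      rw [hg', hre, hw, Real.exp_neg, ← div_eq_mul_inv, div_le_one (Real.exp_pos _),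
        show a - (a + b) / 2 = -((b - a) / 2) by ring, Real.cos_neg, div_self hba.ne', mul_one]
      exact hfa w hw
    · intro w hw
      rw [hg', hre, hw, Real.exp_neg, ← div_eq_mul_inv, div_le_one (Real.exp_pos _),
        show b - (a + b) / 2 = (b - a) / 2 by ring, sub_self, zero_div, mul_zero, add_zero]
      exact hfb w hw
  rw [hg', Real.exp_neg, ← div_eq_mul_inv, div_le_one (Real.exp_pos _), hre] at key
  refine key.trans (Real.exp_le_exp.2 ?_)
  gcongr
  exact mul_le_of_le_one_left (Real.cosh_pos _).le (Real.cos_le_one _)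

lemma Complex.norm_sin_sq_eq (z : ℂ) :
    ‖Complex.sin z‖ ^ 2 = (Real.cosh (2 * z.im) - Real.cos (2 * z.re)) / 2 := by
  rw [Complex.sq_norm, Complex.normSq_apply]
  conv_lhs => rw [← Complex.re_add_im z]
  rw [Complex.sin_add_mul_I]
  simp only [← Complex.ofReal_sin, ← Complex.ofReal_cos, ← Complex.ofReal_sinh,
    ← Complex.ofReal_cosh, ← Complex.ofReal_mul]
  simp only [Complex.add_re, Complex.ofReal_re, Complex.re_ofReal_mul, Complex.I_re, Complex.add_im,
    Complex.ofReal_im, Complex.im_ofReal_mul, Complex.I_im]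
  rw [Real.cosh_two_mul, Real.cos_two_mul]
  nlinarith [Real.sin_sq_add_cos_sq z.re, Real.cosh_sq z.im]

lemma Complex.sin_ne_zero_of_re_mem_Ioo {z : ℂ} (h0 : 0 < z.re) (h1 : z.re < π) :
    Complex.sin z ≠ 0 := by
  intro h
  obtain ⟨k, rfl⟩ := Complex.sin_eq_zero_iff.1 h
  have e : ((k : ℂ) * (π : ℂ)).re = k * π := by simp
  rw [e] at h0 h1
  have hk0 : (0 : ℝ) < k := pos_of_mul_pos_left h0 Real.pi_pos.le
  have hk1 : (k : ℝ) < 1 := by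
    by_contra! hk
    nlinarith [Real.pi_pos]
  have : (0 : ℤ) < k := by exact_mod_cast hk0
  have : k < 1 := by exact_mod_cast hk1
  omega

lemma Complex.eq_zero_of_sin_eq_zero {z : ℂ} (h0 : |z.re| < π) (h : Complex.sin z = 0) :
    z = 0 := by
  obtain ⟨k, rfl⟩ := Complex.sin_eq_zero_iff.1 h
  have e : ((k : ℂ) * (π : ℂ)).re = k * π := by simp
  rw [e, abs_mul, abs_of_pos Real.pi_pos] at h0
  have hk1 : |(k : ℝ)| < 1 := by
    by_contra! hk
    nlinarith [Real.pi_pos]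
  have : |k| < 1 := by exact_mod_cast hk1
  rw [Int.abs_lt_one_iff.1 this]
  simp

/-- The Blaschke factor of the vertical strip `a < re z < b` with zero at `ρ`. -/
noncomputable def stripBlaschke (a b : ℝ) (ρ z : ℂ) : ℂ :=
  Complex.sin ((π / (2 * (b - a)) : ℝ) * (z - ρ)) /
    Complex.sin ((π / (2 * (b - a)) : ℝ) * (z - 2 * a + (starRingEnd ℂ) ρ))

lemma norm_stripBlaschke_sq (a b : ℝ) (ρ z : ℂ) :
    ‖stripBlaschke a b ρ z‖ ^ 2 =
      (Real.cosh (π / (b - a) * (z.im - ρ.im)) - Real.cos (π / (b - a) * (z.re - ρ.re))) /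
      (Real.cosh (π / (b - a) * (z.im - ρ.im)) -
        Real.cos (π / (b - a) * (z.re + ρ.re - 2 * a))) := by
  have e (x : ℝ) : 2 * (π / (2 * (b - a)) * x) = π / (b - a) * x := by
    rw [← mul_assoc, ← mul_div_assoc, mul_div_mul_left _ _ two_ne_zero]
  have e2 : z.re - 2 * a + ρ.re = z.re + ρ.re - 2 * a := by ring
  rw [stripBlaschke, norm_div, div_pow, Complex.norm_sin_sq_eq, Complex.norm_sin_sq_eq,
    div_div_div_cancel_right₀ two_ne_zero]
  simp only [Complex.re_ofReal_mul, Complex.im_ofReal_mul, e, Complex.sub_im, Complex.sub_re,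
    Complex.add_re, Complex.add_im, Complex.conj_re, Complex.conj_im]
  simp only [Complex.mul_re, Complex.mul_im, Complex.re_ofNat, Complex.im_ofNat, Complex.ofReal_re,
    Complex.ofReal_im]
  simp only [mul_zero, zero_mul, sub_zero, add_zero, e2, ← sub_eq_add_neg]

lemma norm_stripBlaschke_left {a b : ℝ} {ρ z : ℂ} (hab : a < b) (h0 : a < ρ.re) (h1 : ρ.re < b)
    (hz : z.re = a) : ‖stripBlaschke a b ρ z‖ = 1 := by
  have hba : 0 < b - a := sub_pos.2 hab
  have h : ‖stripBlaschke a b ρ z‖ ^ 2 = 1 := by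
    have hc : Real.cos (π / (b - a) * (ρ.re - a)) < 1 := by
      rw [← Real.cos_zero]
      refine Real.cos_lt_cos_of_nonneg_of_le_pi le_rfl ?_ (mul_pos (by positivity) (by linarith))
      rw [div_mul_eq_mul_div, div_le_iff₀ hba]
      nlinarith [Real.pi_pos]
    rw [norm_stripBlaschke_sq, hz, show a + ρ.re - 2 * a = ρ.re - a by ring,
      show a - ρ.re = -(ρ.re - a) by ring, mul_neg, Real.cos_neg, div_self]
    linarith [Real.one_le_cosh (π / (b - a) * (z.im - ρ.im))]
  exact (pow_eq_one_iff_of_nonneg (norm_nonneg _) two_ne_zero).1 h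

lemma norm_stripBlaschke_right {a b : ℝ} {ρ z : ℂ} (hab : a < b) (h0 : a < ρ.re) (h1 : ρ.re < b)
    (hz : z.re = b) : ‖stripBlaschke a b ρ z‖ = 1 := by
  have hba : 0 < b - a := sub_pos.2 hab
  have h : ‖stripBlaschke a b ρ z‖ ^ 2 = 1 := by
    have hc : Real.cos (π / (b - a) * (b - ρ.re)) < 1 := by
      rw [← Real.cos_zero]
      refine Real.cos_lt_cos_of_nonneg_of_le_pi le_rfl ?_ (mul_pos (by positivity) (by linarith))
      rw [div_mul_eq_mul_div, div_le_iff₀ hba]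
      nlinarith [Real.pi_pos]
    have e : π / (b - a) * (b + ρ.re - 2 * a) = 2 * π - π / (b - a) * (b - ρ.re) := by
      field_simp
      ring
    rw [norm_stripBlaschke_sq, hz, e, Real.cos_two_pi_sub, div_self]
    linarith [Real.one_le_cosh (π / (b - a) * (z.im - ρ.im))]
  exact (pow_eq_one_iff_of_nonneg (norm_nonneg _) two_ne_zero).1 h

lemma half_le_norm_stripBlaschke {a b : ℝ} {ρ z : ℂ} (hab : a < b)
    (h : |ρ.im| + 3 * (b - a) / π ≤ |z.im|) : 1 / 2 ≤ ‖stripBlaschke a b ρ z‖ := by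
  have hba : 0 < b - a := sub_pos.2 hab
  have h1 : 3 ≤ |π / (b - a) * (z.im - ρ.im)| := by
    have h2 : 3 * (b - a) / π ≤ |z.im - ρ.im| := by
      linarith [abs_sub_abs_le_abs_sub z.im ρ.im]
    rw [div_le_iff₀ Real.pi_pos] at h2
    rw [abs_mul, abs_of_pos (by positivity), div_mul_eq_mul_div, le_div_iff₀ hba]
    linarith
  set x := π / (b - a) * (z.im - ρ.im)
  have h3 : 2 ≤ Real.cosh x := by
    rw [← Real.cosh_abs, Real.cosh_eq]
    linarith [Real.add_one_le_exp |x|, Real.exp_pos (-|x|)]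
  have h4 : (1 / 2) ^ 2 ≤ ‖stripBlaschke a b ρ z‖ ^ 2 := by
    rw [norm_stripBlaschke_sq, le_div_iff₀]
    · linarith [Real.cos_le_one (π / (b - a) * (z.re - ρ.re)),
        Real.neg_one_le_cos (π / (b - a) * (z.re + ρ.re - 2 * a))]
    · linarith [Real.cos_le_one (π / (b - a) * (z.re + ρ.re - 2 * a))]
  exact (pow_le_pow_iff_left₀ (by norm_num) (norm_nonneg _) two_ne_zero).1 h4

lemma stripBlaschke_denom_ne_zero {a b δ : ℝ} {ρ z : ℂ} (hab : a < b) (h0 : a + δ < ρ.re)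
    (h1 : ρ.re < b - δ) (hz : z ∈ Complex.re ⁻¹' Set.Ioo (a - δ) (b + δ)) :
    Complex.sin ((π / (2 * (b - a)) : ℝ) * (z - 2 * a + (starRingEnd ℂ) ρ)) ≠ 0 := by
  have hba : 0 < b - a := sub_pos.2 hab
  have e : (((π / (2 * (b - a)) : ℝ) : ℂ) * (z - 2 * a + (starRingEnd ℂ) ρ)).re
      = π / (2 * (b - a)) * (z.re - 2 * a + ρ.re) := by
    rw [Complex.re_ofReal_mul]
    simp
  obtain ⟨hz0, hz1⟩ := hz
  apply Complex.sin_ne_zero_of_re_mem_Ioo <;> rw [e]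
  · exact mul_pos (by positivity) (by linarith)
  · rw [div_mul_eq_mul_div, div_lt_iff₀ (by positivity)]
    nlinarith [Real.pi_pos]

lemma stripBlaschke_num_ne_zero {a b δ : ℝ} {ρ z : ℂ} (hab : a < b) (h0 : a + δ < ρ.re)
    (h1 : ρ.re < b - δ) (hz : z ∈ Complex.re ⁻¹' Set.Ioo (a - δ) (b + δ)) (hne : z ≠ ρ) :
    Complex.sin ((π / (2 * (b - a)) : ℝ) * (z - ρ)) ≠ 0 := by
  have hba : 0 < b - a := sub_pos.2 hab
  intro h
  have h2 := Complex.eq_zero_of_sin_eq_zero ?_ h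
  · have h3 : (((π / (2 * (b - a)) : ℝ)) : ℂ) ≠ 0 := by
      exact_mod_cast (by positivity : π / (2 * (b - a)) ≠ 0)
    exact hne (sub_eq_zero.1 ((mul_eq_zero.1 h2).resolve_left h3))
  · obtain ⟨hz0, hz1⟩ := hz
    rw [Complex.re_ofReal_mul, abs_mul, abs_of_pos (by positivity), div_mul_eq_mul_div,
      div_lt_iff₀ (by positivity), Complex.sub_re]
    have : |z.re - ρ.re| < b - a := abs_lt.2 ⟨by linarith, by linarith⟩
    nlinarith [Real.pi_pos]

lemma exists_eq_mul_stripBlaschke {a b δ : ℝ} {ρ : ℂ} (hab : a < b) (hδ : 0 < δ)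
    (h0 : a + δ < ρ.re) (h1 : ρ.re < b - δ) {f : ℂ → ℂ}
    (hf : DifferentiableOn ℂ f (Complex.re ⁻¹' Set.Ioo (a - δ) (b + δ)))
    (hg : ExpGrowthInStrip a b f) (hρ : f ρ = 0) :
    ∃ g : ℂ → ℂ, DifferentiableOn ℂ g (Complex.re ⁻¹' Set.Ioo (a - δ) (b + δ)) ∧
      ExpGrowthInStrip a b g ∧
      ∀ z ∈ Complex.re ⁻¹' Set.Ioo (a - δ) (b + δ), f z = g z * stripBlaschke a b ρ z := by
  have hba : 0 < b - a := sub_pos.2 hab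
  set U := Complex.re ⁻¹' Set.Ioo (a - δ) (b + δ) with hU
  have hUρ : U ∈ nhds ρ := (isOpen_Ioo.preimage Complex.continuous_re).mem_nhds
    ⟨by linarith, by linarith⟩
  set k : ℂ := ((π / (2 * (b - a)) : ℝ) : ℂ) with hk
  have hk0 : k ≠ 0 := Complex.ofReal_ne_zero.2 (by positivity)
  set S : ℂ → ℂ := fun z ↦ Complex.sin (k * (z - ρ)) with hS
  have hSd : Differentiable ℂ S := by simp only [hS]; fun_prop
  have hS0 : ∀ z, S z = (z - ρ) * dslope S ρ z := by
    intro z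
    have := sub_smul_dslope S ρ z
    rw [smul_eq_mul] at this
    rw [this]
    simp [hS]
  have hf0 : ∀ z, f z = (z - ρ) * dslope f ρ z := by
    intro z
    have := sub_smul_dslope f ρ z
    rw [smul_eq_mul] at this
    rw [this, hρ, sub_zero]
  have hSne : ∀ z ∈ U, dslope S ρ z ≠ 0 := by
    intro z hz
    by_cases hzρ : z = ρ
    · rw [hzρ, dslope_same]
      have : HasDerivAt S (Complex.cos (k * (ρ - ρ)) * (k * 1)) ρ :=
        (((hasDerivAt_id ρ).sub_const ρ).const_mul k).csin
      rw [this.deriv]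
      simpa using hk0
    · intro h
      exact stripBlaschke_num_ne_zero hab h0 h1 hz hzρ (by have := hS0 z; rwa [h, mul_zero] at this)
  set g : ℂ → ℂ := fun z ↦ dslope f ρ z *
    Complex.sin (k * (z - 2 * a + (starRingEnd ℂ) ρ)) / dslope S ρ z with hgdef
  have hfac : ∀ z ∈ U, f z = g z * stripBlaschke a b ρ z := by
    intro z hz
    have h2 := hSne z hz
    have h3 := stripBlaschke_denom_ne_zero hab h0 h1 hz
    rw [stripBlaschke, ← hk, hf0, show Complex.sin (k * (z - ρ)) = S z from rfl, hS0]
    rw [← hk] at h3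
    simp only [hgdef]
    field_simp
  refine ⟨g, ?_, ?_, hfac⟩
  · refine DifferentiableOn.div (DifferentiableOn.mul ?_ ?_) ?_ hSne
    · exact (Complex.differentiableOn_dslope hUρ).2 hf
    · refine Differentiable.differentiableOn ?_
      fun_prop
    · exact (Complex.differentiableOn_dslope hUρ).2 hSd.differentiableOn
  · obtain ⟨K, C, hKC⟩ := hg
    refine ⟨max K (|ρ.im| + 3 * (b - a) / π), 2 * |C|, fun z hza hzb hz ↦ ?_⟩
    have h2 := half_le_norm_stripBlaschke (ρ := ρ) hab ((le_max_right _ _).trans hz)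
    have h3 := hKC z hza hzb ((le_max_left _ _).trans hz)
    rw [hfac z ⟨by linarith, by linarith⟩, norm_mul] at h3
    have h4 : C * Real.exp (K * |z.im|) ≤
        |C| * Real.exp (max K (|ρ.im| + 3 * (b - a) / π) * |z.im|) := by
      refine mul_le_mul (le_abs_self C) ?_ (Real.exp_pos _).le (abs_nonneg C)
      gcongr
      exact le_max_left _ _
    nlinarith [norm_nonneg (g z)]

lemma exists_eq_mul_prod_stripBlaschke {a b δ : ℝ} (hab : a < b) (hδ : 0 < δ) (Z : Finset ℂ)
    (hZ : ∀ ρ ∈ Z, a + δ < ρ.re ∧ ρ.re < b - δ) {f : ℂ → ℂ}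
    (hf : DifferentiableOn ℂ f (Complex.re ⁻¹' Set.Ioo (a - δ) (b + δ)))
    (hg : ExpGrowthInStrip a b f) (hfZ : ∀ ρ ∈ Z, f ρ = 0) :
    ∃ g : ℂ → ℂ, DifferentiableOn ℂ g (Complex.re ⁻¹' Set.Ioo (a - δ) (b + δ)) ∧
      ExpGrowthInStrip a b g ∧
      ∀ z ∈ Complex.re ⁻¹' Set.Ioo (a - δ) (b + δ), f z = g z * ∏ ρ ∈ Z, stripBlaschke a b ρ z := by
  induction Z using Finset.induction_on with
  | empty => exact ⟨f, hf, hg, fun z _ ↦ by simp⟩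
  | insert ρ Z hρZ ih =>
    obtain ⟨g, hgd, hgg, hgf⟩ := ih (fun w hw ↦ hZ w (Finset.mem_insert_of_mem hw))
      (fun w hw ↦ hfZ w (Finset.mem_insert_of_mem hw))
    obtain ⟨h0, h1⟩ := hZ ρ (Finset.mem_insert_self ρ Z)
    have hρU : ρ ∈ Complex.re ⁻¹' Set.Ioo (a - δ) (b + δ) := ⟨by linarith, by linarith⟩
    have hgρ : g ρ = 0 := by
      have h2 := hgf ρ hρU
      rw [hfZ ρ (Finset.mem_insert_self ρ Z)] at h2
      refine (mul_eq_zero.1 h2.symm).resolve_right (Finset.prod_ne_zero_iff.2 fun w hw ↦ ?_)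
      obtain ⟨h3, h4⟩ := hZ w (Finset.mem_insert_of_mem hw)
      refine div_ne_zero (stripBlaschke_num_ne_zero hab h3 h4 hρU ?_)
        (stripBlaschke_denom_ne_zero hab h3 h4 hρU)
      rintro rfl
      exact hρZ hw
    obtain ⟨g', hgd', hgg', hgf'⟩ := exists_eq_mul_stripBlaschke hab hδ h0 h1 hgd hgg hgρ
    refine ⟨g', hgd', hgg', fun z hz ↦ ?_⟩
    rw [Finset.prod_insert hρZ, hgf z hz, hgf' z hz, mul_assoc]

/-- The three lines bound `norm_le_of_strip_boundary`, sharpened by the Blaschke factors of a finite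
set of zeros. -/
lemma norm_le_prod_stripBlaschke_mul {a b δ E L t₀ : ℝ} (hab : a < b) (hpi : b - a < π)
    (hδ : 0 < δ) (hE : 0 ≤ E) (Z : Finset ℂ)
    (hZ : ∀ ρ ∈ Z, a + δ < ρ.re ∧ ρ.re < b - δ) {f : ℂ → ℂ}
    (hf : DifferentiableOn ℂ f (Complex.re ⁻¹' Set.Ioo (a - δ) (b + δ)))
    (hg : ExpGrowthInStrip a b f) (hfZ : ∀ ρ ∈ Z, f ρ = 0)
    (hfa : ∀ z : ℂ, z.re = a →
      ‖f z‖ ≤ Real.exp (E * (Real.cos ((b - a) / 2) * Real.cosh (z.im - t₀)) + L))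
    (hfb : ∀ z : ℂ, z.re = b →
      ‖f z‖ ≤ Real.exp (E * (Real.cos ((b - a) / 2) * Real.cosh (z.im - t₀))))
    {z : ℂ} (hza : a ≤ z.re) (hzb : z.re ≤ b) :
    ‖f z‖ ≤ (∏ ρ ∈ Z, ‖stripBlaschke a b ρ z‖) *
      Real.exp (E * Real.cosh (z.im - t₀) + L * ((b - z.re) / (b - a))) := by
  obtain ⟨g, hgd, hgg, hgf⟩ := exists_eq_mul_prod_stripBlaschke hab hδ Z hZ hf hg hfZ
  have hnorm (w : ℂ) (h1 : a ≤ w.re) (h2 : w.re ≤ b) :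
      ‖f w‖ = (∏ ρ ∈ Z, ‖stripBlaschke a b ρ w‖) * ‖g w‖ := by
    rw [hgf w ⟨by linarith, by linarith⟩, norm_mul, norm_prod, mul_comm]
  rw [hnorm z hza hzb]
  refine mul_le_mul_of_nonneg_left ?_ (Finset.prod_nonneg fun _ _ ↦ norm_nonneg _)
  refine norm_le_of_strip_boundary hab hpi (by linarith) (by linarith) hE hgd hgg
    (fun w hw ↦ ?_) (fun w hw ↦ ?_) hza hzb
  · have h1 := hnorm w hw.ge (by linarith)
    rw [Finset.prod_eq_one fun ρ hρ ↦ norm_stripBlaschke_left hab (by linarith [(hZ ρ hρ).1])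
      (by linarith [(hZ ρ hρ).2]) hw, one_mul] at h1
    exact h1 ▸ hfa w hw
  · have h1 := hnorm w (by linarith) hw.le
    rw [Finset.prod_eq_one fun ρ hρ ↦ norm_stripBlaschke_right hab (by linarith [(hZ ρ hρ).1])
      (by linarith [(hZ ρ hρ).2]) hw, one_mul] at h1
    exact h1 ▸ hfb w hw

lemma Complex.norm_Gamma_le_of_re_pos {s : ℂ} (hs : 0 < s.re) :
    ‖Complex.Gamma s‖ ≤ Real.Gamma s.re := by
  rw [Complex.Gamma_eq_integral hs, Real.Gamma_eq_integral hs, Complex.GammaIntegral]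
  refine (MeasureTheory.norm_integral_le_integral_norm _).trans (le_of_eq ?_)
  refine MeasureTheory.setIntegral_congr_fun measurableSet_Ioi fun x hx ↦ ?_
  rw [norm_mul, Complex.norm_cpow_eq_rpow_re_of_pos hx, Complex.norm_of_nonneg (Real.exp_pos _).le]
  simp

lemma MellinConvergent.norm_mellin_le {f : ℝ → ℂ} {a b : ℝ} (ha : MellinConvergent f a)
    (hb : MellinConvergent f b) {s : ℂ} (hs : MellinConvergent f s) (hsa : a ≤ s.re)
    (hsb : s.re ≤ b) :
    ‖mellin f s‖ ≤ ∫ t in Set.Ioi (0 : ℝ), (‖(t : ℂ) ^ ((a : ℂ) - 1) • f t‖ +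
      ‖(t : ℂ) ^ ((b : ℂ) - 1) • f t‖) := by
  refine (MeasureTheory.norm_integral_le_integral_norm _).trans ?_
  refine MeasureTheory.setIntegral_mono_on hs.norm (ha.norm.add hb.norm) measurableSet_Ioi
    fun t ht ↦ ?_
  have ht0 : 0 < t := ht
  simp only [norm_smul, ← add_mul]
  refine mul_le_mul_of_nonneg_right ?_ (norm_nonneg _)
  rw [Complex.norm_cpow_eq_rpow_re_of_pos ht0, Complex.norm_cpow_eq_rpow_re_of_pos ht0,
    Complex.norm_cpow_eq_rpow_re_of_pos ht0]
  simp only [Complex.sub_re, Complex.ofReal_re, Complex.one_re]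
  rcases le_total 1 t with h | h
  · have := Real.rpow_le_rpow_of_exponent_le h (by linarith : s.re - 1 ≤ b - 1)
    have := Real.rpow_pos_of_pos ht0 (a - 1)
    linarith
  · have := Real.rpow_le_rpow_of_exponent_ge ht0 h (by linarith : a - 1 ≤ s.re - 1)
    have := Real.rpow_pos_of_pos ht0 (b - 1)
    linarith

lemma exists_norm_completedRiemannZeta₀_le (a b : ℝ) :
    ∃ M, ∀ s : ℂ, a ≤ s.re → s.re ≤ b → ‖completedRiemannZeta₀ s‖ ≤ M := by
  set P := HurwitzZeta.hurwitzEvenFEPair 0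
  have hP (s : ℂ) : MellinConvergent P.f_modif s :=
    (P.isStrongFEPair_toStrongFEPair.hasMellin s).1
  refine ⟨(∫ t in Set.Ioi (0 : ℝ), (‖(t : ℂ) ^ (((a / 2 : ℝ) : ℂ) - 1) • P.f_modif t‖ +
    ‖(t : ℂ) ^ (((b / 2 : ℝ) : ℂ) - 1) • P.f_modif t‖)) / ‖(2 : ℂ)‖, fun s hsa hsb ↦ ?_⟩
  have h := MellinConvergent.norm_mellin_le (hP (a / 2 : ℝ)) (hP (b / 2 : ℝ)) (hP (s / 2))
    (by rw [Complex.div_ofNat_re]; linarith) (by rw [Complex.div_ofNat_re]; linarith)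
  have e : completedRiemannZeta₀ s = mellin P.f_modif (s / 2) / 2 := rfl
  rw [e, norm_div]
  exact div_le_div_of_nonneg_right h (norm_nonneg _)

lemma Complex.norm_sin_le_exp (z : ℂ) : ‖Complex.sin z‖ ≤ Real.exp |z.im| := by
  rw [← pow_le_pow_iff_left₀ (norm_nonneg _) (Real.exp_pos _).le two_ne_zero,
    Complex.norm_sin_sq_eq, ← Real.cosh_abs, Real.cosh_eq, ← Real.exp_nat_mul]
  have h1 : Real.exp (-|2 * z.im|) ≤ 1 := Real.exp_le_one_iff.2 (by simp)
  have h2 : 1 ≤ Real.exp |2 * z.im| := Real.one_le_exp (abs_nonneg _)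
  have h3 : |2 * z.im| = (2 : ℕ) * |z.im| := by simp [abs_mul]
  rw [← h3]
  linarith [Real.neg_one_le_cos (2 * z.re)]

lemma exists_Gamma_le_of_mem_Icc {a b : ℝ} (ha : 0 < a) :
    ∃ M, ∀ x, a ≤ x → x ≤ b → Real.Gamma x ≤ M := by
  have h : ContinuousOn Real.Gamma (Set.Icc a b) := fun x hx ↦
    (Real.differentiableAt_Gamma fun m ↦ by
      have : 0 < x := ha.trans_le hx.1
      have := Nat.cast_nonneg (α := ℝ) m
      linarith).continuousAt.continuousWithinAt
  obtain ⟨M, hM⟩ := (isCompact_Icc.image_of_continuousOn h).bddAbove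
  exact ⟨M, fun x h1 h2 ↦ hM ⟨x, ⟨h1, h2⟩, rfl⟩⟩

lemma Complex.inv_Gammaℝ_eq {s : ℂ} (hs : s.re < 2) :
    (s.Gammaℝ)⁻¹ = (2 - s).Gammaℝ * Complex.sin (π * s / 2) := by
  have h := Complex.Gammaℝ_one_sub_mul_Gammaℝ_one_add (1 - s)
  rw [show (π : ℂ) * (1 - s) / 2 = π / 2 - π * s / 2 by ring, Complex.cos_pi_div_two_sub,
    sub_sub_cancel, show 1 + (1 - s) = 2 - s by ring] at h
  have h2 : (2 - s).Gammaℝ ≠ 0 := Complex.Gammaℝ_ne_zero_of_re_pos (by simpa using hs)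
  rw [eq_div_of_mul_eq h2 h, inv_div, div_inv_eq_mul]

lemma expGrowthInStrip_inv_Gammaℝ {a b : ℝ} (hb : b < 2) :
    ExpGrowthInStrip a b fun s ↦ (s.Gammaℝ)⁻¹ := by
  obtain ⟨M, hM⟩ := exists_Gamma_le_of_mem_Icc (a := (2 - b) / 2) (b := (2 - a) / 2) (by linarith)
  refine ⟨π / 2, M, fun z hza hzb _ ↦ ?_⟩
  have hre : ((2 - z) / 2).re = (2 - z.re) / 2 := by rw [Complex.div_ofNat_re]; simp
  have h1 : ‖(2 - z).Gammaℝ‖ ≤ M := by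
    rw [Complex.Gammaℝ_def, norm_mul, Complex.norm_cpow_eq_rpow_re_of_pos Real.pi_pos]
    have h2 : ‖Complex.Gamma ((2 - z) / 2)‖ ≤ M :=
      (Complex.norm_Gamma_le_of_re_pos (by rw [hre]; linarith)).trans
        (hM _ (by rw [hre]; linarith) (by rw [hre]; linarith))
    refine (mul_le_of_le_one_left (norm_nonneg _) ?_).trans h2
    refine Real.rpow_le_one_of_one_le_of_nonpos (by linarith [Real.pi_gt_three]) ?_
    rw [neg_div, Complex.neg_re, hre]
    linarith
  have h2 : ‖Complex.sin (π * z / 2)‖ ≤ Real.exp (π / 2 * |z.im|) := by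
    refine (Complex.norm_sin_le_exp _).trans (le_of_eq ?_)
    rw [Complex.div_ofNat_im, Complex.im_ofReal_mul, abs_div, abs_mul, abs_of_pos Real.pi_pos,
      abs_two, mul_div_right_comm]
  simp only [Complex.inv_Gammaℝ_eq (hzb.trans_lt hb), norm_mul]
  exact mul_le_mul h1 h2 (norm_nonneg _) ((norm_nonneg _).trans h1)

lemma expGrowthInStrip_riemannZeta {a b : ℝ} (hb : b < 2) :
    ExpGrowthInStrip a b riemannZeta := by
  obtain ⟨K, C, hK⟩ := expGrowthInStrip_inv_Gammaℝ (a := a) hb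
  obtain ⟨M, hM⟩ := exists_norm_completedRiemannZeta₀_le a b
  refine ⟨max K 1, (M + 2) * |C|, fun z hza hzb hz ↦ ?_⟩
  have h1 : 1 ≤ |z.im| := (le_max_right _ _).trans hz
  have hz1 : 1 ≤ ‖z‖ := h1.trans (Complex.abs_im_le_norm z)
  have hz2 : 1 ≤ ‖1 - z‖ := h1.trans (by simpa using Complex.abs_im_le_norm (1 - z))
  have hM0 : ‖completedRiemannZeta z‖ ≤ M + 2 := by
    rw [completedRiemannZeta_eq]
    have h3 : ‖1 / z‖ ≤ 1 := by
      rw [norm_div, norm_one]; exact (div_le_one (by linarith)).2 hz1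
    have h4 : ‖1 / (1 - z)‖ ≤ 1 := by
      rw [norm_div, norm_one]; exact (div_le_one (by linarith)).2 hz2
    have h5 := norm_sub_le (completedRiemannZeta₀ z - 1 / z) (1 / (1 - z))
    have h6 := norm_sub_le (completedRiemannZeta₀ z) (1 / z)
    linarith [hM z hza hzb]
  rw [riemannZeta_def_of_ne_zero (norm_pos_iff.1 (by linarith)), div_eq_mul_inv, norm_mul,
    mul_assoc]
  refine mul_le_mul hM0 ?_ (norm_nonneg _) ((norm_nonneg _).trans hM0)
  refine (hK z hza hzb ((le_max_left _ _).trans hz)).trans ?_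
  refine mul_le_mul (le_abs_self C) ?_ (Real.exp_pos _).le (abs_nonneg C)
  gcongr
  exact le_max_left _ _

lemma Complex.norm_cos_le_exp (z : ℂ) : ‖Complex.cos z‖ ≤ Real.exp |z.im| := by
  have h := Complex.norm_sin_le_exp (π / 2 - z)
  rw [Complex.sin_pi_div_two_sub] at h
  refine h.trans (le_of_eq ?_)
  rw [Complex.sub_im, Complex.div_ofNat_im]
  simp

/-- The factor in the functional equation `ζ(1 - s) = zetaFactor s * ζ(s)`. -/
noncomputable def zetaFactor (s : ℂ) : ℂ := s.Gammaℂ * Complex.cos (π * s / 2)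

lemma riemannZeta_one_sub_eq_zetaFactor {s : ℂ} (hs : 0 < s.re) (h1 : s ≠ 1) :
    riemannZeta (1 - s) = zetaFactor s * riemannZeta s := by
  rw [riemannZeta_one_sub (fun n h ↦ ?_) h1, zetaFactor, Complex.Gammaℂ_def]
  rw [h] at hs
  simp only [Complex.neg_re, Complex.natCast_re] at hs
  linarith [Nat.cast_nonneg (α := ℝ) n]

lemma norm_zetaFactor_of_re_eq_half {s : ℂ} (hs : s.re = 1 / 2) : ‖zetaFactor s‖ = 1 := by
  have h1 : 1 - s = (starRingEnd ℂ) s := by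
    apply Complex.ext <;> simp [hs]
    norm_num
  have h2 : (1 - s).Gammaℝ ≠ 0 := Complex.Gammaℝ_ne_zero_of_re_pos (by simp [hs]; norm_num)
  rw [zetaFactor, ← Complex.Gammaℝ_div_Gammaℝ_one_sub (fun n h ↦ ?_), norm_div]
  · have h3 : ‖(1 - s).Gammaℝ‖ = ‖s.Gammaℝ‖ := by
      rw [h1, Complex.Gammaℝ_def, Complex.Gammaℝ_def, norm_mul, norm_mul,
        Complex.norm_cpow_eq_rpow_re_of_pos Real.pi_pos,
        Complex.norm_cpow_eq_rpow_re_of_pos Real.pi_pos,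
        show (starRingEnd ℂ) s / 2 = (starRingEnd ℂ) (s / 2) by
          rw [map_div₀, map_ofNat], Complex.Gamma_conj,
        Complex.norm_conj, Complex.div_ofNat_re, Complex.div_ofNat_re, Complex.neg_re,
        Complex.neg_re, Complex.conj_re]
    rw [h3, div_self]
    rwa [← h3, norm_ne_zero_iff]
  · rw [h] at hs
    simp at hs
    linarith [Nat.cast_nonneg (α := ℝ) n]

lemma norm_zetaFactor_add_one {s : ℂ} (hs : s.re = 1 / 2) :
    ‖zetaFactor (s + 1)‖ = ‖s‖ / (2 * π) := by
  have h0 : s ≠ 0 := fun h ↦ by simp [h] at hs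
  have h1 : 1 - s = (starRingEnd ℂ) s := by
    apply Complex.ext <;> simp [hs]
    norm_num
  have h2 : ‖Complex.cos (π * (s + 1) / 2)‖ = ‖Complex.cos (π * s / 2)‖ := by
    rw [show (π : ℂ) * (s + 1) / 2 = π * s / 2 + π / 2 by ring, Complex.cos_add_pi_div_two,
      norm_neg, ← Complex.cos_pi_div_two_sub,
      show (π : ℂ) / 2 - π * s / 2 = π * (1 - s) / 2 by ring,
      h1, show (π : ℂ) * (starRingEnd ℂ) s / 2 = (starRingEnd ℂ) (π * s / 2) by
        rw [map_div₀, map_ofNat, map_mul, Complex.conj_ofReal],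
      Complex.cos_conj, Complex.norm_conj]
  have h3 := norm_zetaFactor_of_re_eq_half hs
  rw [zetaFactor, norm_mul] at h3 ⊢
  rw [h2, Complex.Gammaℂ_add_one h0, norm_div, norm_div, norm_mul]
  rw [show ‖s.Gammaℂ‖ * ‖s‖ / ‖(2 : ℂ)‖ / ‖(π : ℂ)‖ * ‖Complex.cos (π * s / 2)‖ =
    (‖s.Gammaℂ‖ * ‖Complex.cos (π * s / 2)‖) * (‖s‖ / ‖(2 : ℂ)‖ / ‖(π : ℂ)‖) by ring, h3, one_mul,
    Complex.norm_of_nonneg Real.pi_pos.le, Complex.norm_ofNat, div_div]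

lemma expGrowthInStrip_zetaFactor_one_sub {a b : ℝ} (hb : b < 1) :
    ExpGrowthInStrip a b fun z ↦ zetaFactor (1 - z) := by
  obtain ⟨M, hM⟩ := exists_Gamma_le_of_mem_Icc (a := 1 - b) (b := 1 - a) (by linarith)
  refine ⟨π / 2, 2 * M, fun z hza hzb _ ↦ ?_⟩
  have hre : (1 - z).re = 1 - z.re := by simp
  have h2 : ‖Complex.Gamma (1 - z)‖ ≤ M :=
    (Complex.norm_Gamma_le_of_re_pos (by rw [hre]; linarith)).trans
      (hM _ (by rw [hre]; linarith) (by rw [hre]; linarith))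
  have h1 : ‖(1 - z).Gammaℂ‖ ≤ 2 * M := by
    rw [Complex.Gammaℂ_def, norm_mul, norm_mul, Complex.norm_ofNat,
      show (2 * π : ℂ) = ((2 * π : ℝ) : ℂ) by simp,
      Complex.norm_cpow_eq_rpow_re_of_pos Real.two_pi_pos, mul_assoc]
    refine mul_le_mul_of_nonneg_left ((mul_le_of_le_one_left (norm_nonneg _) ?_).trans h2)
      two_pos.le
    refine Real.rpow_le_one_of_one_le_of_nonpos (by linarith [Real.pi_gt_three]) ?_
    rw [Complex.neg_re, hre]
    linarith
  have h3 : ‖Complex.cos (π * (1 - z) / 2)‖ ≤ Real.exp (π / 2 * |z.im|) := by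
    refine (Complex.norm_cos_le_exp _).trans (le_of_eq ?_)
    rw [Complex.div_ofNat_im, Complex.im_ofReal_mul, abs_div, abs_mul, abs_of_pos Real.pi_pos,
      abs_two, mul_div_right_comm]
    simp
  simp only [zetaFactor, norm_mul]
  exact mul_le_mul h1 h3 (norm_nonneg _) ((norm_nonneg _).trans h1)

lemma differentiableAt_zetaFactor {s : ℂ} (hs : 0 < s.re) : DifferentiableAt ℂ zetaFactor s := by
  have h : DifferentiableAt ℂ Complex.Gammaℂ s := by
    have h1 : DifferentiableAt ℂ Complex.Gamma s := Complex.differentiableAt_Gamma _ fun n h ↦ by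
      rw [h] at hs
      simp only [Complex.neg_re, Complex.natCast_re] at hs
      linarith [Nat.cast_nonneg (α := ℝ) n]
    have h2 : DifferentiableAt ℂ (fun s : ℂ ↦ (2 * (π : ℂ)) ^ (-s)) s :=
      (differentiableAt_id.neg).const_cpow (Or.inl (by simp [Real.pi_ne_zero]))
    exact (h2.const_mul 2).mul h1
  refine h.mul ?_
  fun_prop

lemma half_add_abs_le_two_mul_cos_half_mul_cosh (y : ℝ) :
    1 / 2 + |y| ≤ 2 * (Real.cos (1 / 2) * Real.cosh y) := by
  have h1 : 7 / 8 ≤ Real.cos (1 / 2) := by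
    have := Real.one_sub_sq_div_two_le_cos (x := 1 / 2)
    linarith
  have h2 : 1 + |y| ^ 2 / 4 ≤ Real.cosh y := by
    rw [← Real.cosh_abs, Real.cosh_eq]
    linarith [Real.quadratic_le_exp_of_nonneg (abs_nonneg y), Real.add_one_le_exp (-|y|)]
  have h3 : 7 / 8 * (1 + |y| ^ 2 / 4) ≤ Real.cos (1 / 2) * Real.cosh y :=
    mul_le_mul h1 h2 (by positivity) (by linarith)
  nlinarith [sq_nonneg (|y| - 1)]

/-- A convexity bound for `zetaFactor`, uniform in the strip `-1/2 ≤ re z ≤ 1/2`. -/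
lemma norm_zetaFactor_one_sub_le {t₀ : ℝ} (ht : 0 < t₀) {z : ℂ} (h0 : -(1 / 2) ≤ z.re)
    (h1 : z.re ≤ 1 / 2) :
    ‖zetaFactor (1 - z)‖ ≤
      Real.exp (2 / t₀ * Real.cosh (z.im - t₀) + Real.log (t₀ / (2 * π)) * (1 / 2 - z.re)) := by
  have key := norm_le_of_strip_boundary (a := -(1 / 2)) (b := 1 / 2) (a' := -1) (b' := 1)
    (E := 2 / t₀) (L := Real.log (t₀ / (2 * π))) (t₀ := t₀) (f := fun z ↦ zetaFactor (1 - z))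
    (by norm_num) (by linarith [Real.pi_gt_three]) (by norm_num) (by norm_num) (by positivity)
    (fun w hw ↦ ?_) (expGrowthInStrip_zetaFactor_one_sub (by norm_num)) (fun w hw ↦ ?_)
    (fun w hw ↦ ?_) h0 h1
  · rwa [show (1 / 2 - -(1 / 2) : ℝ) = 1 by norm_num, div_one] at key
  · have h2 : 0 < (1 - w).re := by simpa using hw.2
    have h3 := (differentiableAt_zetaFactor h2).comp w (differentiableAt_id.const_sub (1 : ℂ))
    exact h3.differentiableWithinAt
  · rw [show (1 / 2 - -(1 / 2)) / 2 = (1 / 2 : ℝ) by norm_num, sub_eq_add_neg, add_comm,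
      norm_zetaFactor_add_one (by simp [hw]), Real.exp_add, Real.exp_log (by positivity), norm_neg,
      mul_div_assoc', div_le_div_iff_of_pos_right (by positivity)]
    have h3 := half_add_abs_le_two_mul_cos_half_mul_cosh (w.im - t₀)
    have h4 : ‖w‖ ≤ 1 / 2 + (t₀ + |w.im - t₀|) := by
      refine (Complex.norm_le_abs_re_add_abs_im w).trans (add_le_add ?_ ?_)
      · rw [hw, abs_neg, abs_of_pos (by norm_num)]
      · have := abs_add_le t₀ (w.im - t₀)
        rwa [add_sub_cancel, abs_of_pos ht] at this
    have h5 := Real.add_one_le_exp (2 / t₀ * (Real.cos (1 / 2) * Real.cosh (w.im - t₀)))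
    have h6 := mul_le_mul_of_nonneg_right h5 ht.le
    have h7 : (2 / t₀ * (Real.cos (1 / 2) * Real.cosh (w.im - t₀)) + 1) * t₀ =
      2 * (Real.cos (1 / 2) * Real.cosh (w.im - t₀)) + t₀ := by field_simp
    linarith
  · rw [norm_zetaFactor_of_re_eq_half (by simp [hw]; norm_num)]
    refine Real.one_le_exp ?_
    have : 0 ≤ Real.cos ((1 / 2 - -(1 / 2)) / 2) := by
      rw [show (1 / 2 - -(1 / 2)) / 2 = (1 / 2 : ℝ) by norm_num]
      exact Real.cos_nonneg_of_mem_Icc ⟨by linarith [Real.pi_gt_three],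
        by linarith [Real.pi_gt_three]⟩
    positivity

lemma tendsto_norm_riemannZeta_eulerProduct {s : ℂ} (hs : 1 < s.re) :
    Filter.Tendsto (fun n : ℕ ↦ ∏ p ∈ Nat.primesBelow n, ‖1 - (p : ℂ) ^ (-s)‖⁻¹) Filter.atTop
      (nhds ‖riemannZeta s‖) := by
  simpa [norm_prod] using (riemannZeta_eulerProduct hs).norm

lemma norm_one_sub_mul_mul_one_sub_le {a b : ℝ} {z : ℂ} (hz : ‖z‖ = 1) (hb : 0 ≤ b) (hba : b ≤ a)
    (ha : a ≤ 1) : ‖1 - a * z‖ * (1 - a) ≤ ‖1 - b * z‖ * (1 - b) := by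
  have h1 : ‖1 - a * z‖ ≤ ‖1 - b * z‖ + (a - b) := by
    have h : (1 - a * z : ℂ) = (1 - b * z) - ((a - b : ℝ) : ℂ) * z := by push_cast; ring
    rw [h]
    refine (norm_sub_le _ _).trans (le_of_eq ?_)
    rw [norm_mul, hz, Complex.norm_of_nonneg (by linarith), mul_one]
  have h2 : 1 - b ≤ ‖1 - b * z‖ := by
    have := norm_sub_norm_le (1 : ℂ) (b * z)
    rwa [norm_one, norm_mul, hz, Complex.norm_of_nonneg hb, mul_one] at this
  nlinarith [mul_le_mul_of_nonneg_right h1 (sub_nonneg.2 ha)]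

lemma natCast_cpow_neg_eq {p : ℕ} (hp : 0 < p) (s : ℂ) :
    (p : ℂ) ^ (-s) = ((p : ℝ) ^ (-s.re) : ℝ) * (p : ℂ) ^ (-(s.im * Complex.I)) := by
  have h : (p : ℂ) ≠ 0 := by exact_mod_cast hp.ne'
  rw [Complex.ofReal_cpow (Nat.cast_nonneg p), Complex.ofReal_natCast, ← Complex.cpow_add _ _ h]
  congr 1
  conv_lhs => rw [← Complex.re_add_im s]
  push_cast
  ring

lemma norm_natCast_cpow_neg_I {p : ℕ} (hp : 0 < p) (t : ℝ) :
    ‖(p : ℂ) ^ (-(t * Complex.I))‖ = 1 := by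
  rw [Complex.norm_natCast_cpow_of_pos hp]
  simp

lemma norm_one_sub_natCast_cpow_neg_ofReal {p : ℕ} (hp : 1 ≤ p) {σ : ℝ} (hσ : 0 ≤ σ) :
    ‖1 - (p : ℂ) ^ (-(σ : ℂ))‖ = 1 - (p : ℝ) ^ (-σ) := by
  have h : (p : ℝ) ^ (-σ) ≤ 1 :=
    Real.rpow_le_one_of_one_le_of_nonpos (by exact_mod_cast hp) (by linarith)
  rw [← Complex.norm_of_nonneg (sub_nonneg.2 h)]
  congr 1
  push_cast [Complex.ofReal_cpow (Nat.cast_nonneg p)]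
  rfl

lemma natCast_rpow_neg_lt_one {p : ℕ} (hp : p.Prime) {σ : ℝ} (hσ : 0 < σ) : (p : ℝ) ^ (-σ) < 1 :=
  Real.rpow_lt_one_of_one_lt_of_neg (by exact_mod_cast hp.one_lt) (by linarith)

lemma norm_riemannZeta_mul_norm_le {s₁ s₂ : ℂ} (h1 : 1 < s₁.re) (h12 : s₁.re ≤ s₂.re)
    (him : s₁.im = s₂.im) :
    ‖riemannZeta s₂‖ * ‖riemannZeta s₂.re‖ ≤ ‖riemannZeta s₁‖ * ‖riemannZeta s₁.re‖ := by
  have h2 : 1 < s₂.re := h1.trans_le h12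
  refine le_of_tendsto_of_tendsto' ((tendsto_norm_riemannZeta_eulerProduct h2).mul
    (tendsto_norm_riemannZeta_eulerProduct (by simpa using h2)))
    ((tendsto_norm_riemannZeta_eulerProduct h1).mul
    (tendsto_norm_riemannZeta_eulerProduct (by simpa using h1))) fun n ↦ ?_
  rw [← Finset.prod_mul_distrib, ← Finset.prod_mul_distrib]
  refine Finset.prod_le_prod (fun p _ ↦ by positivity) fun p hp ↦ ?_
  have hpp := Nat.prime_of_mem_primesBelow hp
  have hlt := natCast_rpow_neg_lt_one hpp (by linarith : 0 < s₁.re)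
  have hz := norm_natCast_cpow_neg_I hpp.pos s₁.im
  rw [← mul_inv, ← mul_inv, norm_one_sub_natCast_cpow_neg_ofReal hpp.one_le (by linarith),
    norm_one_sub_natCast_cpow_neg_ofReal hpp.one_le (by linarith), natCast_cpow_neg_eq hpp.pos s₁,
    natCast_cpow_neg_eq hpp.pos s₂, ← him]
  refine inv_anti₀ (mul_pos ?_ (by linarith))
    (norm_one_sub_mul_mul_one_sub_le hz (by positivity) ?_ hlt.le)
  · rw [norm_pos_iff, sub_ne_zero]
    intro h
    have h3 := congrArg norm h
    rw [norm_mul, hz, norm_one, Complex.norm_of_nonneg (by positivity)] at h3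
    linarith
  · exact Real.rpow_le_rpow_of_exponent_le (by exact_mod_cast hpp.one_le) (by linarith)

lemma one_le_norm_riemannZeta_mul_norm {s : ℂ} (h1 : 1 < s.re) :
    1 ≤ ‖riemannZeta s‖ * ‖riemannZeta s.re‖ := by
  refine ge_of_tendsto' ((tendsto_norm_riemannZeta_eulerProduct h1).mul
    (tendsto_norm_riemannZeta_eulerProduct (by simpa using h1))) fun n ↦ ?_
  rw [← Finset.prod_mul_distrib, ← Finset.prod_const_one (s := Nat.primesBelow n)]
  refine Finset.prod_le_prod (fun p _ ↦ zero_le_one) fun p hp ↦ ?_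
  have hpp := Nat.prime_of_mem_primesBelow hp
  have hlt := natCast_rpow_neg_lt_one hpp (by linarith : 0 < s.re)
  have hz := norm_natCast_cpow_neg_I hpp.pos s.im
  rw [← mul_inv, norm_one_sub_natCast_cpow_neg_ofReal hpp.one_le (by linarith),
    natCast_cpow_neg_eq hpp.pos s]
  refine (one_le_inv₀ (mul_pos ?_ (by linarith))).2 ?_
  · rw [norm_pos_iff, sub_ne_zero]
    intro h
    have h3 := congrArg norm h
    rw [norm_mul, hz, norm_one, Complex.norm_of_nonneg (by positivity)] at h3
    linarith
  · simpa using norm_one_sub_mul_mul_one_sub_le hz le_rfl (by positivity) hlt.le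

lemma norm_riemannZeta_le {s : ℂ} (h1 : 1 < s.re) : ‖riemannZeta s‖ ≤ ‖riemannZeta s.re‖ := by
  refine le_of_tendsto_of_tendsto' (tendsto_norm_riemannZeta_eulerProduct h1)
    (tendsto_norm_riemannZeta_eulerProduct (by simpa using h1)) fun n ↦ ?_
  refine Finset.prod_le_prod (fun p _ ↦ by positivity) fun p hp ↦ ?_
  have hpp := Nat.prime_of_mem_primesBelow hp
  have hlt := natCast_rpow_neg_lt_one hpp (by linarith : 0 < s.re)
  rw [norm_one_sub_natCast_cpow_neg_ofReal hpp.one_le (by linarith), natCast_cpow_neg_eq hpp.pos s]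
  refine inv_anti₀ (by linarith) ?_
  have h := norm_sub_norm_le (1 : ℂ) (((p : ℝ) ^ (-s.re) : ℝ) * (p : ℂ) ^ (-(s.im * Complex.I)))
  rwa [norm_one, norm_mul, norm_natCast_cpow_neg_I hpp.pos, Complex.norm_of_nonneg (by positivity),
    mul_one] at h

lemma norm_riemannZeta_ofReal {σ : ℝ} (h1 : 1 < σ) :
    ‖riemannZeta σ‖ = 1 / (σ - 1) + 1 - σ * ZetaAsymptotics.termTSum σ := by
  have h : riemannZeta σ = ((∑' n : ℕ, 1 / (n + 1 : ℝ) ^ σ : ℝ) : ℂ) := by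
    rw [zeta_eq_tsum_one_div_nat_add_one_cpow (by simpa using h1), Complex.ofReal_tsum]
    congr 1 with n
    push_cast [Complex.ofReal_cpow (by positivity : (0 : ℝ) ≤ n + 1)]
    rfl
  rw [h, Complex.norm_of_nonneg (tsum_nonneg fun n ↦ by positivity)]
  linarith [ZetaAsymptotics.zeta_limit_aux1 h1]

lemma norm_riemannZeta_ofReal_le {σ : ℝ} (h1 : 1 < σ) : ‖riemannZeta σ‖ ≤ 1 / (σ - 1) + 1 := by
  have h : 0 ≤ ZetaAsymptotics.termTSum σ := tsum_nonneg fun n ↦ ZetaAsymptotics.term_nonneg _ _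
  rw [norm_riemannZeta_ofReal h1]
  nlinarith

lemma ZetaAsymptotics.term_le_term_one (n : ℕ) {s : ℝ} (hs : 1 ≤ s) :
    ZetaAsymptotics.term (n + 1) s ≤ ZetaAsymptotics.term (n + 1) 1 := by
  rw [ZetaAsymptotics.term, ZetaAsymptotics.term]
  refine intervalIntegral.integral_mono_on (by simp)
    (ZetaAsymptotics.term_welldef n.succ_pos (zero_lt_one.trans_le hs))
    (ZetaAsymptotics.term_welldef n.succ_pos zero_lt_one) fun x hx ↦ ?_
  have : 1 ≤ x := le_trans (by simp) hx.1
  gcongr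
  exact sub_nonneg.mpr hx.1

lemma le_norm_riemannZeta_ofReal {σ : ℝ} (h1 : 1 < σ) :
    1 / (σ - 1) + 1 - σ / 2 ≤ ‖riemannZeta σ‖ := by
  have h : ZetaAsymptotics.termTSum σ ≤ 1 / 2 := by
    have h2 : ZetaAsymptotics.termTSum σ ≤ 1 - Real.eulerMascheroniConstant := by
      rw [← ZetaAsymptotics.term_tsum_one.tsum_eq]
      exact Summable.tsum_le_tsum (fun n ↦ ZetaAsymptotics.term_le_term_one n h1.le)
        (ZetaAsymptotics.term_tsum_one.summable.of_nonneg_of_le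
          (fun n ↦ ZetaAsymptotics.term_nonneg _ _)
          fun n ↦ ZetaAsymptotics.term_le_term_one n h1.le)
        ZetaAsymptotics.term_tsum_one.summable
    linarith [Real.one_half_lt_eulerMascheroniConstant]
  rw [norm_riemannZeta_ofReal h1]
  nlinarith

/-- The quotient `(s - 1) ζ(s) / ((s + 4 / 3) ζ(7 / 3 - s))`, with its removable singularity
filled in. -/
noncomputable def zetaQuotient (s : ℂ) : ℂ :=
  riemannZeta₁ s / (s + 4 / 3) * (riemannZeta (7 / 3 - s))⁻¹

lemma norm_zetaQuotient {s : ℂ} (h1 : s ≠ 1) :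
    ‖zetaQuotient s‖ = ‖s - 1‖ / ‖s + 4 / 3‖ * ‖riemannZeta s‖ * ‖riemannZeta (7 / 3 - s)‖⁻¹ := by
  have h := riemannZeta_eq_inv_sub_mul h1
  have h' : s - 1 ≠ 0 := sub_ne_zero.2 h1
  have h2 : riemannZeta₁ s = (s - 1) * riemannZeta s := by
    rw [h, mul_inv_cancel_left₀ h']
  rw [zetaQuotient, h2, norm_mul, norm_div, norm_mul, norm_inv]
  ring

lemma differentiableOn_zetaQuotient :
    DifferentiableOn ℂ zetaQuotient (Complex.re ⁻¹' Set.Ioo (-(4 / 3)) (4 / 3)) := by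
  intro z hz
  have hre : 1 < (7 / 3 - z : ℂ).re := by
    have := hz.2
    simp only [Complex.sub_re, Complex.div_ofNat_re, Complex.re_ofNat]
    linarith
  have h1 : (7 / 3 - z : ℂ) ≠ 1 := fun h ↦ by simp [h] at hre
  have h2 : z + 4 / 3 ≠ 0 := fun h ↦ by
    have h3 := congrArg Complex.re h
    have := hz.1
    simp only [Complex.add_re, Complex.div_ofNat_re, Complex.re_ofNat, Complex.zero_re] at h3
    linarith
  refine DifferentiableAt.differentiableWithinAt ?_
  refine ((differentiable_riemannZeta₁ z).div (by fun_prop) h2).mul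
    (DifferentiableAt.inv ?_ (riemannZeta_ne_zero_of_one_lt_re hre))
  exact DifferentiableAt.comp z (differentiableAt_riemannZeta h1) (by fun_prop)

lemma inv_norm_riemannZeta_le {s : ℂ} (h1 : 1 < s.re) :
    ‖riemannZeta s‖⁻¹ ≤ 1 / (s.re - 1) + 1 := by
  have h := one_le_norm_riemannZeta_mul_norm h1
  have h2 := norm_riemannZeta_ofReal_le h1
  have h0 : 0 < ‖riemannZeta s‖ := norm_pos_iff.2 (riemannZeta_ne_zero_of_one_lt_re h1)
  rw [inv_le_iff_one_le_mul₀ h0]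
  nlinarith

lemma norm_sub_one_div_le_one {s : ℂ} (hs : -(1 / 6) ≤ s.re) : ‖s - 1‖ / ‖s + 4 / 3‖ ≤ 1 := by
  refine div_le_one_of_le₀ ?_ (norm_nonneg _)
  rw [← sq_le_sq₀ (norm_nonneg _) (norm_nonneg _), Complex.sq_norm, Complex.sq_norm,
    Complex.normSq_apply, Complex.normSq_apply]
  simp only [Complex.add_re, Complex.div_ofNat_re, Complex.re_ofNat, Complex.sub_re, Complex.one_re,
    Complex.sub_im, Complex.one_im, Complex.add_im, Complex.div_ofNat_im, Complex.im_ofNat]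
  nlinarith

lemma norm_zetaQuotient_le {s : ℂ} (h1 : s ≠ 1) (h0 : -(1 / 6) ≤ s.re) (h2 : s.re ≤ 7 / 6) :
    ‖zetaQuotient s‖ ≤ 7 * ‖riemannZeta s‖ := by
  have hre : (7 / 3 - s : ℂ).re = 7 / 3 - s.re := by
    simp only [Complex.sub_re, Complex.div_ofNat_re, Complex.re_ofNat]
  have h3 := inv_norm_riemannZeta_le (s := 7 / 3 - s) (by rw [hre]; linarith)
  have h4 : 1 / ((7 / 3 - s : ℂ).re - 1) + 1 ≤ 7 := by
    rw [hre, ← le_sub_iff_add_le, div_le_iff₀ (by linarith)]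
    linarith
  rw [norm_zetaQuotient h1, mul_comm]
  refine mul_le_mul (h3.trans h4) ?_ (by positivity) (by norm_num)
  exact mul_le_of_le_one_left (norm_nonneg _) (norm_sub_one_div_le_one h0)

lemma expGrowthInStrip_zetaQuotient : ExpGrowthInStrip (-(1 / 6)) (7 / 6) zetaQuotient := by
  obtain ⟨K, C, h⟩ := expGrowthInStrip_riemannZeta (a := -(1 / 6)) (b := 7 / 6) (by norm_num)
  refine ⟨max K 1, 7 * max C 0, fun z h1 h2 h3 ↦ ?_⟩
  have hz : z ≠ 1 := fun hz ↦ by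
    rw [hz, Complex.one_im, abs_zero] at h3
    linarith [le_max_right K 1]
  refine (norm_zetaQuotient_le hz h1 h2).trans ?_
  rw [mul_assoc]
  refine mul_le_mul_of_nonneg_left ((h z h1 h2 ((le_max_left _ _).trans h3)).trans ?_) (by norm_num)
  gcongr
  · exact le_max_left _ _
  · exact le_max_left _ _

lemma norm_zetaQuotient_right {s : ℂ} (hs : s.re = 7 / 6) : ‖zetaQuotient s‖ ≤ 1 := by
  have h1 : s ≠ 1 := fun h ↦ by norm_num [h] at hs
  have h2 : (7 / 3 - s : ℂ) = (starRingEnd ℂ) s := by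
    apply Complex.ext
    · simp only [Complex.sub_re, Complex.div_ofNat_re, Complex.re_ofNat, Complex.conj_re]
      linarith
    · simp
  have h0 : ‖riemannZeta s‖ ≠ 0 :=
    norm_ne_zero_iff.2 (riemannZeta_ne_zero_of_one_lt_re (by rw [hs]; norm_num))
  rw [norm_zetaQuotient h1, h2, riemannZeta_conj, Complex.norm_conj, mul_assoc,
    mul_inv_cancel₀ h0, mul_one]
  exact norm_sub_one_div_le_one (by linarith)

lemma norm_zetaQuotient_left {s : ℂ} {t₀ : ℝ} (ht : 0 < t₀) (hs : s.re = -(1 / 6)) :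
    ‖zetaQuotient s‖ ≤ Real.exp (2 / t₀ * Real.cosh (s.im - t₀) +
      (2 / 3 * Real.log (t₀ / (2 * π)) + Real.log (35 / 3))) := by
  have h1 : s ≠ 1 := fun h ↦ by norm_num [h] at hs
  have hs0 : (1 - s : ℂ) ≠ 1 := fun h ↦ by
    have h2 : s = 0 := by linear_combination -h
    norm_num [h2] at hs
  have hre : (7 / 3 - s : ℂ).re = 5 / 2 := by
    simp only [Complex.sub_re, Complex.div_ofNat_re, Complex.re_ofNat, hs]
    norm_num
  have hre1 : (1 - s : ℂ).re = 7 / 6 := by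
    simp only [Complex.sub_re, Complex.one_re, hs]
    norm_num
  have h3 := inv_norm_riemannZeta_le (s := 7 / 3 - s) (by rw [hre]; norm_num)
  have h4 := norm_zetaFactor_one_sub_le (z := s) ht (by linarith) (by linarith)
  have h5 : ‖riemannZeta (1 - s)‖ ≤ 7 := by
    refine (norm_riemannZeta_le (by rw [hre1]; norm_num)).trans ?_
    refine (norm_riemannZeta_ofReal_le (by rw [hre1]; norm_num)).trans ?_
    rw [hre1]
    norm_num
  have h6 : riemannZeta s = zetaFactor (1 - s) * riemannZeta (1 - s) := by
    rw [← riemannZeta_one_sub_eq_zetaFactor (by rw [hre1]; norm_num) hs0, sub_sub_cancel]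
  rw [hre] at h3
  rw [norm_zetaQuotient h1, ← add_assoc, Real.exp_add, Real.exp_log (by norm_num), h6, norm_mul]
  have h7 : 2 / t₀ * Real.cosh (s.im - t₀) + Real.log (t₀ / (2 * π)) * (1 / 2 - s.re) =
      2 / t₀ * Real.cosh (s.im - t₀) + 2 / 3 * Real.log (t₀ / (2 * π)) := by
    rw [hs]
    ring
  rw [h7] at h4
  calc _ ≤ 1 * (Real.exp (2 / t₀ * Real.cosh (s.im - t₀) + 2 / 3 * Real.log (t₀ / (2 * π))) * 7) *
        (1 / (5 / 2 - 1) + 1) := by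
        gcongr
        exact norm_sub_one_div_le_one (by linarith)
    _ = _ := by ring

lemma le_norm_zetaQuotient {s : ℂ} (hs : s.re = 17 / 15) (ht : 10000 ≤ s.im) :
    0.63 ≤ ‖zetaQuotient s‖ := by
  have h1 : s ≠ 1 := fun h ↦ by norm_num [h] at hs
  have hre : (7 / 3 - s : ℂ).re = 6 / 5 := by
    simp only [Complex.sub_re, Complex.div_ofNat_re, Complex.re_ofNat, hs]
    norm_num
  have hc : ‖riemannZeta (7 / 3 - s)‖ = ‖riemannZeta (6 / 5 + s.im * Complex.I)‖ := by
    rw [← Complex.norm_conj, ← riemannZeta_conj]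
    congr 2
    apply Complex.ext
    · rw [Complex.conj_re, hre]
      simp
    · rw [Complex.conj_im]
      simp
  have hre' : (6 / 5 + s.im * Complex.I : ℂ).re = 6 / 5 := by simp
  have hmain := norm_riemannZeta_mul_norm_le (s₁ := s) (s₂ := 6 / 5 + s.im * Complex.I)
    (by rw [hs]; norm_num) (by rw [hs, hre']; norm_num) (by simp)
  rw [← hc, hre', hs] at hmain
  have h2 := le_norm_riemannZeta_ofReal (σ := 6 / 5) (by norm_num)
  have h3 := norm_riemannZeta_ofReal_le (σ := 17 / 15) (by norm_num)
  norm_num1 at h2 h3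
  have h0 : 0 < ‖riemannZeta (7 / 3 - s)‖ :=
    norm_pos_iff.2 (riemannZeta_ne_zero_of_one_lt_re (by rw [hre]; norm_num))
  have hratio : 27 / 5 / (17 / 2) ≤ ‖riemannZeta s‖ * ‖riemannZeta (7 / 3 - s)‖⁻¹ := by
    rw [← div_eq_mul_inv, div_le_div_iff₀ (by norm_num) h0]
    calc 27 / 5 * ‖riemannZeta (7 / 3 - s)‖
        ≤ ‖riemannZeta (6 / 5 : ℝ)‖ * ‖riemannZeta (7 / 3 - s)‖ := by gcongr
      _ ≤ ‖riemannZeta s‖ * ‖riemannZeta (17 / 15 : ℝ)‖ := by rwa [mul_comm]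
      _ ≤ _ := by gcongr
  have h4 : 0.999 ≤ ‖s - 1‖ / ‖s + 4 / 3‖ := by
    have h5 : s.im ≤ ‖s - 1‖ := by
      simpa using (le_abs_self _).trans (Complex.abs_im_le_norm (s - 1))
    have h6 : ‖s + 4 / 3‖ ≤ 37 / 15 + s.im := by
      refine (Complex.norm_le_abs_re_add_abs_im _).trans (le_of_eq ?_)
      simp only [Complex.add_re, Complex.div_ofNat_re, Complex.re_ofNat, hs, Complex.add_im,
        Complex.div_ofNat_im, Complex.im_ofNat]
      rw [abs_of_pos (by norm_num), zero_div, add_zero, abs_of_pos (by linarith)]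
      norm_num
    have h7 : 0 < ‖s + 4 / 3‖ := by
      refine norm_pos_iff.2 fun h ↦ ?_
      have h8 := congrArg Complex.re h
      simp only [Complex.add_re, Complex.div_ofNat_re, Complex.re_ofNat, hs, Complex.zero_re] at h8
      norm_num at h8
    rw [le_div_iff₀ h7]
    linarith
  rw [norm_zetaQuotient h1, mul_assoc]
  calc (0.63 : ℝ) ≤ 0.999 * (27 / 5 / (17 / 2)) := by norm_num
    _ ≤ _ := by gcongr

lemma le_prod_stripBlaschke_mul {t₀ : ℝ} (ht : 10000 ≤ t₀) (Z : Finset ℂ)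
    (hZ : ∀ ρ ∈ Z, riemannZeta ρ = 0 ∧ 0 < ρ.re ∧ ρ.re < 1) :
    0.63 ≤ (∏ ρ ∈ Z, ‖stripBlaschke (-(1 / 6)) (7 / 6) ρ (17 / 15 + t₀ * Complex.I)‖) *
      Real.exp (4 / t₀ + (2 / 3 * Real.log (t₀ / (2 * π)) + Real.log (35 / 3)) * (1 / 40)) := by
  have ht0 : 0 < t₀ := by linarith
  set s : ℂ := 17 / 15 + t₀ * Complex.I with hs
  have hre : s.re = 17 / 15 := by simp [hs]
  have him : s.im = t₀ := by simp [hs]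
  refine (le_norm_zetaQuotient hre (by rw [him]; exact ht)).trans ?_
  have h := norm_le_prod_stripBlaschke_mul (a := -(1 / 6)) (b := 7 / 6) (δ := 1 / 20) (E := 4 / t₀)
    (L := 2 / 3 * Real.log (t₀ / (2 * π)) + Real.log (35 / 3)) (t₀ := t₀) (f := zetaQuotient)
    (z := s)
    (by norm_num) (by linarith [Real.pi_gt_three]) (by norm_num) (by positivity) Z
    (fun ρ hρ ↦ ⟨by linarith [(hZ ρ hρ).2.1], by linarith [(hZ ρ hρ).2.2]⟩)
    (differentiableOn_zetaQuotient.mono ?_) expGrowthInStrip_zetaQuotient ?_ ?_ ?_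
    (by rw [hre]; norm_num) (by rw [hre]; norm_num)
  · refine h.trans (le_of_eq ?_)
    rw [him, sub_self, Real.cosh_zero, hre]
    norm_num
  · rintro z ⟨h1, h2⟩
    exact ⟨by linarith, by linarith⟩
  · intro ρ hρ
    have h1 : ρ ≠ 1 := fun h1 ↦ by
      have := (hZ ρ hρ).2.2
      simp [h1] at this
    rw [← norm_eq_zero, norm_zetaQuotient h1, (hZ ρ hρ).1]
    simp
  · intro z hz
    refine (norm_zetaQuotient_left ht0 hz).trans (Real.exp_le_exp.2 (add_le_add_left ?_ _))
    rw [← mul_assoc]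
    refine mul_le_mul_of_nonneg_right ?_ (Real.cosh_pos _).le
    have hcos : 1 / 2 ≤ Real.cos ((7 / 6 - -(1 / 6)) / 2) := by
      refine le_trans ?_ (Real.one_sub_sq_div_two_le_cos)
      norm_num
    calc 2 / t₀ = 4 / t₀ * (1 / 2) := by ring
      _ ≤ _ := by gcongr
  · intro z hz
    refine (norm_zetaQuotient_right hz).trans (Real.one_le_exp ?_)
    have : 0 ≤ Real.cos ((7 / 6 - -(1 / 6)) / 2) := by
      refine le_trans ?_ (Real.one_sub_sq_div_two_le_cos)
      norm_num
    have := Real.cosh_pos (z.im - t₀)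
    positivity

lemma kernel_polynomial_nonneg {u a : ℝ} (hu1 : 1 ≤ u) (hu2 : u ≤ 9 / 5) (ha1 : 19 / 50 ≤ a)
    (ha2 : a ≤ 1) :
    0.59 * ((u ^ 2 + a ^ 2 + 0.6384 - 0.99383) ^ 2 +
      4 * 0.6384 * (a ^ 2 - 0.99383) * (u ^ 2 - 1)) ≤
      1.28 * a * u * (u ^ 2 + a ^ 2 + 0.6384 - 0.99383) := by
  have h (i j : ℕ) :
      0 ≤ (u - 1) ^ i * (9 / 5 - u) ^ (4 - i) * ((a - 19 / 50) ^ j * (1 - a) ^ (4 - j)) := by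
    have h1 := sub_nonneg.2 hu1
    have h2 := sub_nonneg.2 hu2
    have h3 := sub_nonneg.2 ha1
    have h4 := sub_nonneg.2 ha2
    positivity
  have h0 := fun i ↦ And.intro (h i 0) <| And.intro (h i 1) <| And.intro (h i 2) <|
    And.intro (h i 3) (h i 4)
  obtain ⟨h00, h01, h02, h03, h04⟩ := h0 0
  obtain ⟨h10, h11, h12, h13, h14⟩ := h0 1
  obtain ⟨h20, h21, h22, h23, h24⟩ := h0 2
  obtain ⟨h30, h31, h32, h33, h34⟩ := h0 3
  obtain ⟨h40, h41, h42, h43, h44⟩ := h0 4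
  clear h h0
  norm_num1 at *
  linarith

lemma le_kernel_add_kernel {u a c₁ c₂ δ : ℝ} (hu1 : 1 ≤ u) (hu2 : u ≤ 9 / 5) (ha1 : 19 / 50 ≤ a)
    (ha2 : a ≤ 1) (h1 : 1 ≤ c₁) (h2 : 1 ≤ c₂) (hadd : c₁ + c₂ = 2.56 * u)
    (hmul : c₁ * c₂ = u ^ 2 + 0.6384) (hδ : 0 ≤ δ) (hδ' : δ ≤ 0.00617) :
    1.18 ≤ c₁ * a / (c₁ ^ 2 - 1 + a ^ 2 + δ) + c₂ * a / (c₂ ^ 2 - 1 + a ^ 2 + δ) := by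
  have hpos {c δ : ℝ} (hc : 1 ≤ c) (hδ : 0 ≤ δ) : 0 < c ^ 2 - 1 + a ^ 2 + δ := by
    nlinarith
  have hmono {c : ℝ} (hc : 1 ≤ c) :
      c * a / (c ^ 2 - 1 + a ^ 2 + 0.00617) ≤ c * a / (c ^ 2 - 1 + a ^ 2 + δ) := by
    have := hpos hc hδ
    gcongr
  refine le_trans ?_ (add_le_add (hmono h1) (hmono h2))
  have hp1 := hpos (δ := 0.00617) h1 (by norm_num)
  have hp2 := hpos (δ := 0.00617) h2 (by norm_num)
  rw [div_add_div _ _ hp1.ne' hp2.ne', le_div_iff₀ (mul_pos hp1 hp2)]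
  have hden : (c₁ ^ 2 - 1 + a ^ 2 + 0.00617) * (c₂ ^ 2 - 1 + a ^ 2 + 0.00617) =
      (u ^ 2 + a ^ 2 + 0.6384 - 0.99383) ^ 2 +
        4 * 0.6384 * (a ^ 2 - 0.99383) * (u ^ 2 - 1) := by
    have h : (c₁ ^ 2 - 1 + a ^ 2 + 0.00617) * (c₂ ^ 2 - 1 + a ^ 2 + 0.00617) =
        (c₁ * c₂ + (a ^ 2 - 0.99383)) ^ 2 +
          (a ^ 2 - 0.99383) * ((c₁ + c₂) ^ 2 - 4 * (c₁ * c₂)) := by ring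
    rw [h, hadd, hmul]
    ring
  have hnum : c₁ * a * (c₂ ^ 2 - 1 + a ^ 2 + 0.00617) + (c₁ ^ 2 - 1 + a ^ 2 + 0.00617) * (c₂ * a) =
      2 * (1.28 * a * u * (u ^ 2 + a ^ 2 + 0.6384 - 0.99383)) := by
    have h : c₁ * a * (c₂ ^ 2 - 1 + a ^ 2 + 0.00617) +
        (c₁ ^ 2 - 1 + a ^ 2 + 0.00617) * (c₂ * a) =
        a * (c₁ + c₂) * (c₁ * c₂ + a ^ 2 - 0.99383) := by ring
    rw [h, hadd, hmul]
    ring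
  rw [hden, hnum]
  linarith [kernel_polynomial_nonneg hu1 hu2 ha1 ha2]

lemma sin_pi_div_forty_bounds : 0.0784 ≤ Real.sin (π / 40) ∧ Real.sin (π / 40) ^ 2 ≤ 0.00617 := by
  have h1 := Real.pi_gt_d6
  have h2 := Real.pi_lt_d6
  have h3 := Real.sin_gt_sub_cube (x := π / 40) (by positivity)
  have h4 := Real.sin_le (x := π / 40) (by positivity)
  have h5 : (π / 40) ^ 3 ≤ 0.07854 ^ 3 := by gcongr; linarith
  have h6 : 0.0784 ≤ Real.sin (π / 40) := by
    norm_num1 at *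
    linarith
  exact ⟨h6, (pow_le_pow_left₀ (by linarith) (h4.trans (by linarith : π / 40 ≤ 0.07854)) 2).trans
    (by norm_num)⟩

lemma le_sin_of_mem_Icc {x : ℝ} (h1 : π / 8 ≤ x) (h2 : x ≤ 7 * π / 8) : 19 / 50 ≤ Real.sin x := by
  have h3 : 19 / 50 ≤ Real.sin (π / 8) := by
    rw [Real.sin_pi_div_eight, le_div_iff₀ (by norm_num)]
    refine Real.le_sqrt_of_sq_le ?_
    have : √2 ≤ 1.42 := Real.sqrt_le_iff.2 (by norm_num)
    norm_num1 at *
    linarith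
  have hpi := Real.pi_pos
  rcases le_total x (π / 2) with h | h
  · exact h3.trans (Real.sin_le_sin_of_le_of_le_pi_div_two (by linarith) h h1)
  · rw [← Real.sin_pi_sub]
    exact h3.trans (Real.sin_le_sin_of_le_of_le_pi_div_two (by linarith) (by linarith)
      (by linarith))

lemma cosh_le_of_abs_le {x : ℝ} (hx : |x| ≤ 3 * π / 8) : Real.cosh x ≤ 9 / 5 := by
  have h1 : Real.cosh x ≤ Real.cosh 1.18 := by
    rw [Real.cosh_le_cosh, abs_of_pos (by norm_num : (0 : ℝ) < 1.18)]
    linarith [Real.pi_lt_d6]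
  refine h1.trans ?_
  have h2 : Real.exp 0.09 ≤ 1 / 0.91 := by
    have := Real.add_one_le_exp (-0.09 : ℝ)
    rw [← neg_neg (0.09 : ℝ), Real.exp_neg, ← one_div]
    gcongr
    linarith
  have h3 : Real.exp 1.18 = Real.exp 1 * Real.exp 0.09 ^ 2 := by
    rw [← Real.exp_nat_mul, ← Real.exp_add]
    norm_num
  have h4 : Real.exp 1.18 ≤ 2.7182818286 * (1 / 0.91) ^ 2 := by
    rw [h3]
    gcongr
    exact Real.exp_one_lt_d9.le
  have h5 : Real.exp (-1.18) ≤ 1 / (2.718 * 1.18) := by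
    have h6 : 2.718 ≤ Real.exp 1 := by linarith [Real.exp_one_gt_d9]
    have h7 : 1.18 ≤ Real.exp 0.18 := by linarith [Real.add_one_le_exp (0.18 : ℝ)]
    rw [Real.exp_neg, ← one_div]
    refine one_div_le_one_div_of_le (by norm_num) ?_
    calc (2.718 * 1.18 : ℝ) ≤ Real.exp 1 * Real.exp 0.18 := by gcongr
      _ = Real.exp 1.18 := by rw [← Real.exp_add]; norm_num
  rw [Real.cosh_eq]
  norm_num1 at *
  linarith

lemma one_sub_div_one_add_le_exp {r : ℝ} (hr : 0 ≤ r) :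
    (1 - r) / (1 + r) ≤ Real.exp (-(2 * r)) := by
  rcases lt_or_ge r 1 with h | h
  · have h1 := Real.hasSum_log_sub_log_of_abs_lt_one (abs_lt.2 ⟨by linarith, h⟩ : |r| < 1)
    have h2 := h1.summable.le_tsum 0 fun n _ ↦ by positivity
    rw [h1.tsum_eq] at h2
    norm_num at h2
    have h3 : 0 < 1 - r := by linarith
    rw [← Real.log_le_iff_le_exp (by positivity), Real.log_div h3.ne' (by positivity)]
    linarith
  · exact (div_nonpos_of_nonpos_of_nonneg (by linarith) (by linarith)).trans (Real.exp_pos _).le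

/-- The contribution of a pair of zeros `ρ`, `1 - conj ρ` to the logarithm of the Blaschke product,
in terms of `a = sin (3π / 4 (Re ρ + 1 / 6))` and `c = cosh (3π / 4 (t₀ - Im ρ))`. -/
noncomputable def pairKernel (a c : ℝ) : ℝ := c * a / (c ^ 2 - 1 + a ^ 2 + Real.sin (π / 40) ^ 2)

lemma norm_stripBlaschke_mul_le {ρ : ℂ} (t₀ : ℝ) (h0 : 0 < ρ.re) (h1 : ρ.re < 1) :
    ‖stripBlaschke (-(1 / 6)) (7 / 6) ρ (17 / 15 + t₀ * Complex.I)‖ *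
      ‖stripBlaschke (-(1 / 6)) (7 / 6) (1 - (starRingEnd ℂ) ρ) (17 / 15 + t₀ * Complex.I)‖ ≤
    Real.exp (-(2 * Real.sin (π / 40) * pairKernel (Real.sin (3 * π / 4 * (ρ.re + 1 / 6)))
      (Real.cosh (3 * π / 4 * (t₀ - ρ.im))))) := by
  have hpi := Real.pi_pos
  set e := Real.sin (π / 40) with he
  set θ := 3 * π / 4 * (ρ.re + 1 / 6) with hθ
  set a := Real.sin θ with ha
  set c := Real.cosh (3 * π / 4 * (t₀ - ρ.im)) with hc
  have he0 : 0 < e := by linarith [sin_pi_div_forty_bounds.1]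
  have ha0 : 0 < a := Real.sin_pos_of_pos_of_lt_pi (by positivity) (by rw [hθ]; nlinarith)
  have hc1 : 1 ≤ c := Real.one_le_cosh _
  have hre : (17 / 15 + t₀ * Complex.I : ℂ).re = 17 / 15 := by simp
  have him : (17 / 15 + t₀ * Complex.I : ℂ).im = t₀ := by simp
  have hB : ‖stripBlaschke (-(1 / 6)) (7 / 6) ρ (17 / 15 + t₀ * Complex.I)‖ ^ 2 =
      (c + Real.cos (θ + π / 40)) / (c + Real.cos (θ - π / 40)) := by
    rw [norm_stripBlaschke_sq, hre, him]
    rw [show π / (7 / 6 - -(1 / 6)) = 3 * π / 4 by ring,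
      show 3 * π / 4 * (17 / 15 - ρ.re) = π - (θ + π / 40) by rw [hθ]; ring,
      show 3 * π / 4 * (17 / 15 + ρ.re - 2 * -(1 / 6)) = π + (θ - π / 40) by rw [hθ]; ring,
      Real.cos_pi_sub, add_comm π, Real.cos_add_pi, sub_neg_eq_add, sub_neg_eq_add]
  have hB' : ‖stripBlaschke (-(1 / 6)) (7 / 6) (1 - (starRingEnd ℂ) ρ)
      (17 / 15 + t₀ * Complex.I)‖ ^ 2 =
      (c - Real.cos (θ - π / 40)) / (c - Real.cos (θ + π / 40)) := by
    rw [norm_stripBlaschke_sq, hre, him, Complex.sub_re, Complex.sub_im, Complex.conj_re,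
      Complex.conj_im, Complex.one_re, Complex.one_im, zero_sub, neg_neg,
      show π / (7 / 6 - -(1 / 6)) = 3 * π / 4 by ring,
      show 3 * π / 4 * (17 / 15 - (1 - ρ.re)) = θ - π / 40 by rw [hθ]; ring,
      show 3 * π / 4 * (17 / 15 + (1 - ρ.re) - 2 * -(1 / 6)) = 2 * π - (θ + π / 40) by
        rw [hθ]; ring,
      Real.cos_two_pi_sub]
  have hx : 0 < c ^ 2 - 1 + a ^ 2 + e ^ 2 := by nlinarith
  refine (pow_le_pow_iff_left₀ (by positivity) (Real.exp_pos _).le two_ne_zero).1 ?_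
  have hr : 0 ≤ 2 * e * pairKernel a c := by
    rw [pairKernel]
    positivity
  rw [mul_pow, hB, hB', ← Real.exp_nat_mul]
  refine le_trans (le_of_eq ?_) ((one_sub_div_one_add_le_exp hr).trans (le_of_eq ?_))
  · rw [div_mul_div_comm, Real.cos_add, Real.cos_sub, pairKernel, ← ha, ← he]
    have hca := Real.sin_sq_add_cos_sq θ
    have hce := Real.sin_sq_add_cos_sq (π / 40)
    rw [← ha] at hca
    rw [← he] at hce
    have hn : (c + (cos θ * cos (π / 40) - a * e)) * (c - (cos θ * cos (π / 40) + a * e)) =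
        (c ^ 2 - 1 + a ^ 2 + e ^ 2) - 2 * e * (c * a) := by
      linear_combination (-cos (π / 40) ^ 2) * hca - (1 - a ^ 2) * hce
    have hd : (c + (cos θ * cos (π / 40) + a * e)) * (c - (cos θ * cos (π / 40) - a * e)) =
        (c ^ 2 - 1 + a ^ 2 + e ^ 2) + 2 * e * (c * a) := by
      linear_combination (-cos (π / 40) ^ 2) * hca - (1 - a ^ 2) * hce
    rw [hn, hd, ← mul_div_assoc, one_sub_div hx.ne', one_add_div hx.ne',
      div_div_div_cancel_right₀ hx.ne']
  · congr 1
    push_cast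
    ring

lemma riemannZeta_one_sub_conj_eq_zero {ρ : ℂ} (h : riemannZeta ρ = 0) (h0 : 0 < ρ.re)
    (h1 : ρ.re < 1) : riemannZeta (1 - (starRingEnd ℂ) ρ) = 0 := by
  have hne : (starRingEnd ℂ) ρ ≠ 1 := fun hρ ↦ by
    have h2 := congrArg Complex.re hρ
    rw [Complex.conj_re, Complex.one_re] at h2
    linarith
  rw [riemannZeta_one_sub_eq_zetaFactor (by rwa [Complex.conj_re]) hne, riemannZeta_conj, h,
    map_zero, mul_zero]

lemma sum_pairKernel_le {t₀ : ℝ} (ht : 10000 ≤ t₀) (Z : Finset ℂ)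
    (hZ : ∀ ρ ∈ Z, riemannZeta ρ = 0 ∧ 0 < ρ.re ∧ ρ.re < 1)
    (hsymm : ∀ ρ ∈ Z, 1 - (starRingEnd ℂ) ρ ∈ Z) :
    Real.sin (π / 40) * ∑ ρ ∈ Z, pairKernel (Real.sin (3 * π / 4 * (ρ.re + 1 / 6)))
      (Real.cosh (3 * π / 4 * (t₀ - ρ.im))) ≤
    4 / t₀ + (2 / 3 * Real.log (t₀ / (2 * π)) + Real.log (35 / 3)) * (1 / 40) + 0.47 := by
  have h := le_prod_stripBlaschke_mul ht Z hZ
  set s : ℂ := 17 / 15 + t₀ * Complex.I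
  set R := 4 / t₀ + (2 / 3 * Real.log (t₀ / (2 * π)) + Real.log (35 / 3)) * (1 / 40)
  set P := ∏ ρ ∈ Z, ‖stripBlaschke (-(1 / 6)) (7 / 6) ρ s‖ with hP
  set k : ℂ → ℝ := fun ρ ↦ pairKernel (Real.sin (3 * π / 4 * (ρ.re + 1 / 6)))
    (Real.cosh (3 * π / 4 * (t₀ - ρ.im)))
  have hP' : P = ∏ ρ ∈ Z, ‖stripBlaschke (-(1 / 6)) (7 / 6) (1 - (starRingEnd ℂ) ρ) s‖ :=
    Finset.prod_nbij' (fun ρ ↦ 1 - (starRingEnd ℂ) ρ) (fun ρ ↦ 1 - (starRingEnd ℂ) ρ) hsymm hsymm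
      (fun ρ _ ↦ by simp) (fun ρ _ ↦ by simp) fun ρ _ ↦ by simp
  have hPP : P ^ 2 ≤ Real.exp (-(Real.sin (π / 40) * ∑ ρ ∈ Z, k ρ)) ^ 2 := by
    rw [sq]
    nth_rewrite 2 [hP']
    rw [hP, ← Finset.prod_mul_distrib]
    refine (Finset.prod_le_prod (fun ρ _ ↦ by positivity) fun ρ hρ ↦
      norm_stripBlaschke_mul_le t₀ (hZ ρ hρ).2.1 (hZ ρ hρ).2.2).trans (le_of_eq ?_)
    rw [← Real.exp_sum, ← Real.exp_nat_mul, Finset.sum_neg_distrib, ← Finset.mul_sum]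
    congr 1
    push_cast
    ring
  have hPle := (pow_le_pow_iff_left₀ (Finset.prod_nonneg fun ρ _ ↦ norm_nonneg _)
    (Real.exp_pos _).le two_ne_zero).1 hPP
  have hexp : Real.exp (-0.47) ≤ 0.63 := by
    have h1 := Real.quadratic_le_exp_of_nonneg (x := 0.235) (by norm_num)
    have h2 : Real.exp 0.47 = Real.exp 0.235 ^ 2 := by
      rw [← Real.exp_nat_mul]
      norm_num
    have h3 : 1.594 ≤ Real.exp 0.47 := by
      rw [h2]
      refine le_trans ?_ (pow_le_pow_left₀ (by norm_num) h1 2)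
      norm_num
    rw [Real.exp_neg, inv_le_comm₀ (Real.exp_pos _) (by norm_num)]
    refine le_trans ?_ h3
    norm_num
  have hfin := (hexp.trans h).trans (mul_le_mul_of_nonneg_right hPle (Real.exp_pos R).le)
  rw [← Real.exp_add, Real.exp_le_exp] at hfin
  linarith

lemma card_zeros_unit_interval_mul_le {T : ℝ} (hT : 20000 ≤ T) (Z : Finset ℂ)
    (hZ : ∀ ρ ∈ Z, riemannZeta ρ = 0 ∧ 0 < ρ.re ∧ ρ.re < 1 ∧ T < ρ.im ∧ ρ.im ≤ T + 1)
    (hsymm : ∀ ρ ∈ Z, 1 - (starRingEnd ℂ) ρ ∈ Z) :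
    Z.card * 0.092512 ≤ Real.log T / 30 + 1.0908 := by
  have hpi := Real.pi_gt_three
  have hZ' : ∀ ρ ∈ Z, riemannZeta ρ = 0 ∧ 0 < ρ.re ∧ ρ.re < 1 := fun ρ hρ ↦
    ⟨(hZ ρ hρ).1, (hZ ρ hρ).2.1, (hZ ρ hρ).2.2.1⟩
  set v := Real.arcosh 1.28 with hv
  have hv0 : 0 ≤ v := Real.arcosh_nonneg (by norm_num)
  have hcv : Real.cosh v = 1.28 := Real.cosh_arcosh (by norm_num)
  have hv1 : v ≤ 1 := by
    rw [← abs_of_nonneg hv0, ← abs_one (α := ℝ), ← Real.cosh_le_cosh, hcv, Real.cosh_eq]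
    linarith [Real.exp_one_gt_d9, Real.exp_pos (-1)]
  set τ := v / (3 * π / 4) with hτ
  have hτ0 : 0 ≤ τ := by positivity
  have hτ1 : τ ≤ 1 / 2 := by
    rw [hτ, div_le_iff₀ (by positivity)]
    linarith
  have hτv : 3 * π / 4 * τ = v := mul_div_cancel₀ v (by positivity)
  have hR {t : ℝ} (h1 : T ≤ t) (h2 : t ≤ T + 1) :
      4 / t + (2 / 3 * Real.log (t / (2 * π)) + Real.log (35 / 3)) * (1 / 40) + 0.47 ≤
        Real.log T / 60 + 0.5454 := by
    have hT0 : 0 < T := by linarith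
    have ht0 : 0 < t := by linarith
    have h3 : 4 / t ≤ 4 / 20000 := by gcongr; linarith
    have h4 : Real.log (t / (2 * π)) ≤ Real.log (T * (1 + 1 / T)) := by
      apply Real.log_le_log (by positivity)
      rw [mul_add, mul_one, mul_one_div_cancel (by positivity)]
      exact (div_le_self (by linarith) (by linarith)).trans h2
    have h5 : Real.log (1 + 1 / T) ≤ 1 / 20000 := by
      refine (Real.log_le_sub_one_of_pos (by positivity)).trans ?_
      rw [add_sub_cancel_left]
      gcongr
    have h6 : Real.log (35 / 3) ≤ 3 := by
      rw [Real.log_le_iff_le_exp (by norm_num), ← mul_one (3 : ℝ)]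
      have h7 : Real.exp (3 * 1) = Real.exp 1 ^ 3 := by
        rw [← Real.exp_nat_mul]
        norm_num
      rw [h7]
      refine le_trans ?_ (pow_le_pow_left₀ (by norm_num) Real.exp_one_gt_d9.le 3)
      norm_num
    rw [Real.log_mul (by positivity) (by positivity)] at h4
    norm_num1 at *
    linarith
  have hp := (sum_pairKernel_le (t₀ := T + 1 / 2 + τ) (by linarith) Z hZ' hsymm).trans
    (hR (by linarith) (by linarith))
  have hm := (sum_pairKernel_le (t₀ := T + 1 / 2 - τ) (by linarith) Z hZ' hsymm).trans
    (hR (by linarith) (by linarith))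
  have hsum := add_le_add hp hm
  rw [← mul_add, ← Finset.sum_add_distrib] at hsum
  have hle := Finset.card_nsmul_le_sum Z (fun ρ ↦
    pairKernel (Real.sin (3 * π / 4 * (ρ.re + 1 / 6)))
      (Real.cosh (3 * π / 4 * (T + 1 / 2 + τ - ρ.im))) +
    pairKernel (Real.sin (3 * π / 4 * (ρ.re + 1 / 6)))
      (Real.cosh (3 * π / 4 * (T + 1 / 2 - τ - ρ.im))))
    1.18 fun ρ hρ ↦ ?_
  · rw [nsmul_eq_mul] at hle
    have he := sin_pi_div_forty_bounds.1
    have h1 := mul_le_mul he hle (by positivity) (by linarith)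
    have h2 := h1.trans hsum
    linarith
  · obtain ⟨-, h0, h1, h2, h3⟩ := hZ ρ hρ
    set x := 3 * π / 4 * (T + 1 / 2 - ρ.im) with hx
    have hx' : |x| ≤ 3 * π / 8 := by
      rw [hx, abs_mul, abs_of_pos (by positivity)]
      have : |T + 1 / 2 - ρ.im| ≤ 1 / 2 := abs_le.2 ⟨by linarith, by linarith⟩
      nlinarith
    have ha := le_sin_of_mem_Icc (x := 3 * π / 4 * (ρ.re + 1 / 6)) (by nlinarith) (by nlinarith)
    have e1 : 3 * π / 4 * (T + 1 / 2 + τ - ρ.im) = x + v := by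
      rw [hx, ← hτv]
      ring
    have e2 : 3 * π / 4 * (T + 1 / 2 - τ - ρ.im) = x - v := by
      rw [hx, ← hτv]
      ring
    rw [pairKernel, pairKernel, e1, e2]
    refine le_kernel_add_kernel (u := Real.cosh x) (Real.one_le_cosh _) (cosh_le_of_abs_le hx') ha
      (Real.sin_le_one _) (Real.one_le_cosh _) (Real.one_le_cosh _) ?_ ?_ (sq_nonneg _)
      sin_pi_div_forty_bounds.2
    · rw [Real.cosh_add, Real.cosh_sub, hcv]
      ring
    · have h4 := Real.cosh_sq v
      have h5 := Real.cosh_sq x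
      rw [hcv] at h4
      have h6 : Real.sinh v ^ 2 = 0.6384 := by
        norm_num1 at *
        linarith
      rw [Real.cosh_add, Real.cosh_sub, hcv]
      linear_combination 0.6384 * h5 - Real.sinh x ^ 2 * h6

lemma zetaZeroCount_add_one_le {T : ℝ} (hT : 0 ≤ T) :
    zetaZeroCount (T + 1) ≤ zetaZeroCount T +
      {ρ : ℂ | riemannZeta ρ = 0 ∧ 0 < ρ.re ∧ ρ.re < 1 ∧ T < ρ.im ∧ ρ.im ≤ T + 1}.ncard := by
  refine le_trans (le_of_eq ?_) (Set.ncard_union_le _ _)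
  rw [zetaZeroCount]
  congr 1
  ext ρ
  simp only [Set.mem_ofPred_eq, Set.mem_union]
  constructor
  · rintro ⟨h, h0, h1, h2, h3⟩
    rcases le_or_gt ρ.im T with h4 | h4
    · exact Or.inl ⟨h, h0, h1, h2, h4⟩
    · exact Or.inr ⟨h, h0, h1, h4, h3⟩
  · rintro (⟨h, h0, h1, h2, h3⟩ | ⟨h, h0, h1, h2, h3⟩)
    · exact ⟨h, h0, h1, h2, by linarith⟩
    · exact ⟨h, h0, h1, by linarith, h3⟩

lemma ncard_zeros_unit_interval_mul_le {T : ℝ} (hT : 20000 ≤ T) :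
    {ρ : ℂ | riemannZeta ρ = 0 ∧ 0 < ρ.re ∧ ρ.re < 1 ∧ T < ρ.im ∧ ρ.im ≤ T + 1}.ncard * 0.092512 ≤
      Real.log T / 30 + 1.0908 := by
  set W := {ρ : ℂ | riemannZeta ρ = 0 ∧ 0 < ρ.re ∧ ρ.re < 1 ∧ T < ρ.im ∧ ρ.im ≤ T + 1}
  by_cases hW : W.Finite
  · rw [Set.ncard_eq_toFinset_card W hW]
    refine card_zeros_unit_interval_mul_le hT _ (fun ρ hρ ↦ (hW.mem_toFinset).1 hρ) fun ρ hρ ↦ ?_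
    obtain ⟨h, h0, h1, h2, h3⟩ := (hW.mem_toFinset).1 hρ
    refine (hW.mem_toFinset).2 ⟨riemannZeta_one_sub_conj_eq_zero h h0 h1, ?_, ?_, ?_, ?_⟩ <;>
      simpa
  · rw [Set.Infinite.ncard hW, Nat.cast_zero, zero_mul]
    have := Real.log_nonneg (by linarith : 1 ≤ T)
    positivity

theorem zero_count_unit_interval_upper (T : ℝ) (hT : 30610046000 < T + 1) :
    (zetaZeroCount (T + 1) : ℝ) - zetaZeroCount T ≤
      (1 / (2 * π) + 0.20152) * Real.log T +
        min (0.4892 * Real.log (Real.log T) + 14.2040)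
          (3.3769 * Real.log (Real.log T) + 2.8062) + 1 / (25 * T) := by
  have hT0 : 0 < T := by linarith
  have h1 := zetaZeroCount_add_one_le hT0.le
  rw [← Nat.cast_le (α := ℝ), Nat.cast_add] at h1
  have h2 := ncard_zeros_unit_interval_mul_le (T := T) (by linarith)
  have hlog : 16 ≤ Real.log T := by
    rw [Real.le_log_iff_exp_le hT0, ← mul_one 16]
    have h3 : Real.exp (16 * 1) = Real.exp 1 ^ 16 := by
      rw [← Real.exp_nat_mul]
      norm_num
    rw [h3]
    refine (pow_le_pow_left₀ (Real.exp_pos _).le (Real.exp_one_lt_d9.le.trans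
      (by norm_num : _ ≤ (3 : ℝ))) 16).trans ?_
    norm_num1
    linarith
  have hloglog : 2.77 ≤ Real.log (Real.log T) := by
    have h3 : Real.log 16 = 4 * Real.log 2 := by
      rw [show (16 : ℝ) = 2 ^ 4 by norm_num, Real.log_pow]
      norm_num
    have := Real.log_le_log (by norm_num) hlog
    linarith [Real.log_two_gt_d9]
  have hmin : 12.16 ≤ min (0.4892 * Real.log (Real.log T) + 14.2040)
      (3.3769 * Real.log (Real.log T) + 2.8062) := by
    refine le_min ?_ ?_ <;>
    · norm_num1 at *
      linarith
  have hpi : 0.15915 ≤ 1 / (2 * π) := by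
    rw [le_div_iff₀ (by positivity)]
    linarith [Real.pi_lt_d6]
  have hT1 : 0 ≤ 1 / (25 * T) := by positivity
  have hslope := mul_le_mul_of_nonneg_right
    (add_le_add_left hpi 0.20152) (by linarith : 0 ≤ Real.log T)
  norm_num1 at *
  linarith
end

section
/- For every real number T ≥ 2, one has ((T+1)/(2π))·log((T+1)/(2πe)) − ((T−1)/(2π))·log((T−1)/(2πe)) > (1/π)·log T + 1/π + log(3/4)/(2π) − (1/π)·log(2πe). -/
open Real

/-- The strict lower bound `2 / T < log (T + 1) - log (T - 1)` for `1 < T`. -/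
theorem two_div_lt_log_add_one_sub_log_sub_one {T : ℝ} (hT : 1 < T) :
    2 / T < Real.log (T + 1) - Real.log (T - 1) := by
  have h1 : 0 < T - 1 := by linarith
  have h := Real.lt_log_one_add_of_pos (show 0 < 2 / (T - 1) by positivity)
  have e1 : 1 + 2 / (T - 1) = (T + 1) / (T - 1) := by field_simp; ring
  have e2 : 2 * (2 / (T - 1)) / (2 / (T - 1) + 2) = 2 / T := by
    have h2 : 2 / (T - 1) + 2 = 2 * T / (T - 1) := by field_simp; ring
    rw [h2]
    field_simp
  rwa [e1, e2, Real.log_div (by linarith) h1.ne'] at h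

theorem main_term_diff_lower_short (T : ℝ) (hT : 2 ≤ T) :
    1 / π * Real.log T + 1 / π + Real.log (3 / 4) / (2 * π) -
        1 / π * Real.log (2 * π * Real.exp 1) <
      (T + 1) / (2 * π) * Real.log ((T + 1) / (2 * π * Real.exp 1)) -
        (T - 1) / (2 * π) * Real.log ((T - 1) / (2 * π * Real.exp 1)) := by
  have hπ := Real.pi_pos
  have hT0 : 0 < T := by linarith
  have hc : 2 * π * Real.exp 1 ≠ 0 := by positivity
  have hp : T + 1 ≠ 0 := by linarith
  have hm : T - 1 ≠ 0 := by linarith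
  have hdiff : 2 < T * (Real.log (T + 1) - Real.log (T - 1)) := by
    have h := two_div_lt_log_add_one_sub_log_sub_one (show 1 < T by linarith)
    rwa [div_lt_iff₀' hT0] at h
  have hsum : Real.log (3 / 4) + 2 * Real.log T ≤ Real.log (T + 1) + Real.log (T - 1) := by
    have h : Real.log (3 / 4 * T ^ 2) ≤ Real.log ((T + 1) * (T - 1)) :=
      Real.log_le_log (by positivity) (by nlinarith)
    rw [Real.log_mul (by norm_num) (by positivity), Real.log_mul hp hm, Real.log_pow] at h
    exact_mod_cast h
  rw [Real.log_div hp hc, Real.log_div hm hc, ← sub_pos]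
  generalize Real.log (2 * π * Real.exp 1) = C
  have key : 0 < (T * (Real.log (T + 1) - Real.log (T - 1)) - 2 +
      (Real.log (T + 1) + Real.log (T - 1) - (Real.log (3 / 4) + 2 * Real.log T))) / (2 * π) :=
    div_pos (by linarith) (by positivity)
  convert key using 1
  field_simp
  ring
end
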